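/- arXiv:1311.0535 — 15 statements merged into one kernel-verified Lean document; each statement's English description precedes it below -/
import Mathlib

section
/- For every real number c > 1/4 and every x ∈ ℝ, the sequence of iterates F_cⁿ(x) diverges to infinity (in fact F_cⁿ(x) → +∞ as n → ∞). -/
open Filter

/-- Each application of `y ↦ y^2 + c` increases its argument by at least `c - 1/4`. -/
theorem add_mul_le_iterate_sq_add (c x : ℝ) (n : ℕ) :
    x + n * (c - 1/4) ≤ (fun y : ℝ => y^2 + c)^[n] x := by
  induction n with
  | zero => simp
  | succ n ih =>
    rw [Function.iterate_succ_apply']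
    push_cast
    nlinarith [sq_nonneg ((fun y : ℝ => y^2 + c)^[n] x - 1/2)]

/-- For every real number `c > 1/4` and every `x : ℝ`, the sequence of iterates
`F_c^[n] x` (where `F_c x = x^2 + c`) tends to `+∞` as `n → ∞`. -/
theorem stmt0 (c : ℝ) (hc : 1/4 < c) (x : ℝ) :
    Tendsto (fun n : ℕ => (fun y : ℝ => y^2 + c)^[n] x) atTop atTop := by
  exact tendsto_atTop_mono (add_mul_le_iterate_sq_add c x) <|
    tendsto_atTop_add_const_left _ x <|
      tendsto_natCast_atTop_atTop.atTop_mul_const (sub_pos.mpr hc)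
end

section
/- For every c < 1/4 and every x ∈ ℝ with x ∉ I = [−p, p], the sequence F_cⁿ(x) diverges to infinity (F_cⁿ(x) → +∞ as n → ∞). -/
open Filter

/-- Outside `[-p, p]`, where `p > 0` is a fixed point of `y ↦ y ^ 2 + c`, the iterates move away
from `p` at least geometrically with ratio `2 * p`. -/
theorem geometric_le_iterate_sq_add {c p x : ℝ} (hp : 0 < p) (hfix : p ^ 2 + c = p)
    (hx : p < |x|) (n : ℕ) :
    p + (2 * p) ^ n * (x ^ 2 - p ^ 2) ≤ (fun y : ℝ => y ^ 2 + c)^[n + 1] x := by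
  induction n with
  | zero => simp; linarith
  | succ n ih =>
    rw [Function.iterate_succ_apply']
    set y := (fun y : ℝ => y ^ 2 + c)^[n + 1] x
    have hd : 0 < x ^ 2 - p ^ 2 := by
      have := sq_lt_sq.2 ((abs_of_pos hp).trans_lt hx)
      linarith
    have ht : 0 < (2 * p) ^ n * (x ^ 2 - p ^ 2) := by positivity
    rw [pow_succ]
    nlinarith [sq_nonneg (y - p), mul_le_mul_of_nonneg_left ih hp.le]

/-- For every `c < 1/4`, with `p = (1 + √(1 - 4c))/2` the larger fixed point of
`F_c x = x^2 + c`, every `x ∉ I = [-p, p]` has `F_c^[n] x → +∞`. -/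
theorem stmt2 (c : ℝ) (hc : c < 1/4) (p : ℝ) (hp : p = (1 + Real.sqrt (1 - 4*c)) / 2)
    (x : ℝ) (hx : x ∉ Set.Icc (-p) p) :
    Tendsto (fun n : ℕ => (fun y : ℝ => y^2 + c)^[n] x) atTop atTop := by
  have hs : 0 < Real.sqrt (1 - 4 * c) := Real.sqrt_pos.2 (by linarith)
  have hsq : Real.sqrt (1 - 4 * c) ^ 2 = 1 - 4 * c := Real.sq_sqrt (by linarith)
  have hp_half : 1 / 2 < p := by rw [hp]; linarith
  have hfix : p ^ 2 + c = p := by rw [hp]; linarith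
  have hx' : p < |x| := by
    rw [Set.mem_Icc, ← abs_le] at hx
    exact not_le.1 hx
  have hd : 0 < x ^ 2 - p ^ 2 := by
    have := sq_lt_sq.2 ((abs_of_pos (by linarith : 0 < p)).trans_lt hx')
    linarith
  rw [← tendsto_add_atTop_iff_nat 1]
  refine tendsto_atTop_mono (geometric_le_iterate_sq_add (by linarith) hfix hx') ?_
  exact tendsto_atTop_add_const_left _ _
    ((tendsto_pow_atTop_atTop_of_one_lt (by linarith)).atTop_mul_const hd)
end

section
/- For every c < −2, the set A₀ = {x ∈ I : F_c(x) < −p} is a nonempty open interval, symmetric about 0, and F_c maps each of the two closed sets [−p, 0] \ A₀ and [0, p] \ A₀ onto the full interval I = [−p, p], i.e. F_c([−p,0] \ A₀) = F_c([0,p] \ A₀) = I. -/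
/-- For every `c < -2`, the set `A₀ = {x ∈ I : F_c x < -p}` is a nonempty open interval
symmetric about `0`, and `F_c` maps each of `[-p,0] \ A₀` and `[0,p] \ A₀` onto `I = [-p,p]`. -/
theorem stmt3 (c : ℝ) (hc : c < -2) (p : ℝ) (hp : p = (1 + Real.sqrt (1 - 4*c)) / 2)
    (A₀ : Set ℝ) (hA₀ : A₀ = {x ∈ Set.Icc (-p) p | x^2 + c < -p}) :
    (∃ q : ℝ, 0 < q ∧ A₀ = Set.Ioo (-q) q) ∧
    ((fun y : ℝ => y^2 + c) '' (Set.Icc (-p) 0 \ A₀) = Set.Icc (-p) p) ∧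
    ((fun y : ℝ => y^2 + c) '' (Set.Icc 0 p \ A₀) = Set.Icc (-p) p) := by
  have hs : Real.sqrt (1 - 4 * c) ^ 2 = 1 - 4 * c := Real.sq_sqrt (by linarith)
  have hs3 : 3 < Real.sqrt (1 - 4 * c) := Real.lt_sqrt_of_sq_lt (by linarith)
  have hp2 : 2 < p := by linarith
  have hfix : p ^ 2 + c = p := by subst hp; linarith
  clear hp hs hs3
  have hpos : 0 < -p - c := by nlinarith
  have hpre : ∀ y ∈ Set.Icc (-p) p, ∃ x ∈ Set.Icc 0 p, x ^ 2 + c = y := by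
    rintro y ⟨hy₁, hy₂⟩
    refine ⟨Real.sqrt (y - c), ⟨Real.sqrt_nonneg _, ?_⟩, ?_⟩
    · exact Real.sqrt_le_iff.2 ⟨by linarith, by linarith⟩
    · rw [Real.sq_sqrt (by linarith)]; ring
  subst hA₀
  refine ⟨⟨Real.sqrt (-p - c), Real.sqrt_pos.2 hpos, ?_⟩, ?_, ?_⟩
  · ext x
    rw [Set.mem_Ioo, ← Real.sq_lt]
    constructor
    · rintro ⟨-, hx⟩
      linarith
    · intro hx
      exact ⟨abs_le.1 (abs_le_of_sq_le_sq (by linarith) (by linarith)), by linarith⟩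
  · ext y
    constructor
    · rintro ⟨x, ⟨⟨hx₁, hx₂⟩, hx⟩, rfl⟩
      refine ⟨not_lt.1 fun h => hx ⟨⟨hx₁, by linarith⟩, h⟩, ?_⟩
      change x ^ 2 + c ≤ p
      nlinarith
    · intro hy
      obtain ⟨x, ⟨hx₁, hx₂⟩, rfl⟩ := hpre y hy
      refine ⟨-x, ⟨⟨by linarith, by linarith⟩, fun h => ?_⟩, by simp⟩
      have := h.2
      rw [neg_sq] at this
      exact not_lt.2 hy.1 this
  · ext y
    constructor
    · rintro ⟨x, ⟨⟨hx₁, hx₂⟩, hx⟩, rfl⟩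
      refine ⟨not_lt.1 fun h => hx ⟨⟨by linarith, hx₂⟩, h⟩, ?_⟩
      change x ^ 2 + c ≤ p
      nlinarith
    · intro hy
      obtain ⟨x, hx, rfl⟩ := hpre y hy
      exact ⟨x, ⟨hx, fun h => not_lt.2 hy.1 h.2⟩, rfl⟩
end

section
/- For every c < −2 and every x ∈ A₀ = {x ∈ I : F_c(x) < −p}, the sequence F_cⁿ(x) diverges to infinity (F_cⁿ(x) → +∞ as n → ∞). -/
open Filter

/-- Beyond a fixed point `p ≥ 1` of `y ↦ y ^ 2 + c`, the distance to `p` at least doubles at each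
step. -/
theorem two_pow_mul_sub_le_iterate_sq_add {c p y : ℝ} (hp : 1 ≤ p) (hfix : p ^ 2 + c = p)
    (hy : p ≤ y) (n : ℕ) : 2 ^ n * (y - p) ≤ (fun y : ℝ => y ^ 2 + c)^[n] y - p := by
  induction n with
  | zero => simp
  | succ n ih =>
    rw [Function.iterate_succ_apply', pow_succ]
    have h : 0 ≤ (2 : ℝ) ^ n * (y - p) := mul_nonneg (by positivity) (sub_nonneg.2 hy)
    generalize (fun y : ℝ => y ^ 2 + c)^[n] y = z at ih ⊢
    nlinarith [mul_nonneg (h.trans ih) (by linarith : 0 ≤ z + p - 2)]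

theorem tendsto_iterate_sq_add_atTop {c p y : ℝ} (hp : 1 ≤ p) (hfix : p ^ 2 + c = p)
    (hy : p < y) : Tendsto (fun n : ℕ => (fun y : ℝ => y ^ 2 + c)^[n] y) atTop atTop := by
  have h : Tendsto (fun n : ℕ => (2 : ℝ) ^ n * (y - p)) atTop atTop :=
    (tendsto_pow_atTop_atTop_of_one_lt one_lt_two).atTop_mul_const (sub_pos.2 hy)
  refine tendsto_atTop_mono (fun n => ?_) h
  linarith [two_pow_mul_sub_le_iterate_sq_add hp hfix hy.le n]

/-- For every `c < -2` and every `x ∈ A₀ = {x ∈ I : F_c x < -p}`, the sequence of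
iterates `F_c^[n] x` tends to `+∞`. -/
theorem stmt4 (c : ℝ) (hc : c < -2) (p : ℝ) (hp : p = (1 + Real.sqrt (1 - 4*c)) / 2)
    (x : ℝ) (hx : x ∈ {x ∈ Set.Icc (-p) p | x^2 + c < -p}) :
    Tendsto (fun n : ℕ => (fun y : ℝ => y^2 + c)^[n] x) atTop atTop := by
  have hs : Real.sqrt (1 - 4 * c) ^ 2 = 1 - 4 * c := Real.sq_sqrt (by linarith)
  have hs1 : 1 ≤ Real.sqrt (1 - 4 * c) := Real.one_le_sqrt.2 (by linarith)
  have hp1 : 1 ≤ p := by linarith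
  have hfix : p ^ 2 + c = p := by
    rw [hp]
    linarith
  have hx2 : x ^ 2 + c < -p := hx.2
  rw [← tendsto_add_atTop_iff_nat 2]
  simp only [Function.iterate_add_apply]
  refine tendsto_iterate_sq_add_atTop hp1 hfix ?_
  change p < (x ^ 2 + c) ^ 2 + c
  nlinarith
end

section
/- For every c < −2 and every n ≥ 0, the set Aₙ is a disjoint union of exactly 2ⁿ nonempty open intervals. -/
/-- `S` is the union of `N` nonempty open subintervals of `[-p, p]`, listed from left to right. -/
def IsUnionOfIntervals (p : ℝ) (N : ℕ) (S : Set ℝ) : Prop :=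
  ∃ a b : ℕ → ℝ, (∀ i < N, -p ≤ a i ∧ a i < b i ∧ b i ≤ p) ∧
    (∀ i j, i < j → j < N → b i ≤ a j) ∧ ∀ x, x ∈ S ↔ ∃ i < N, a i < x ∧ x < b i

/-- The preimage under `x ↦ x ^ 2 + c` has twice as many intervals: each interval pulls back to
one interval on each side of `0`. -/
theorem IsUnionOfIntervals.preimage {p c : ℝ} {N : ℕ} {S T : Set ℝ} (hp : 0 ≤ p)
    (hfix : p ^ 2 + c = p) (hpc : 0 < -p - c) (h : IsUnionOfIntervals p N S)
    (hT : ∀ x, x ∈ T ↔ x ^ 2 + c ∈ S) : IsUnionOfIntervals p (2 * N) T := by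
  obtain ⟨a, b, hab, hord, hS⟩ := h
  have hlt : ∀ i < N, √(a i - c) < √(b i - c) := fun i hi =>
    Real.sqrt_lt_sqrt (by linarith [(hab i hi).1]) (by linarith [(hab i hi).2.1])
  have hle : ∀ i < N, √(b i - c) ≤ p := fun i hi =>
    (Real.sqrt_le_left hp).2 (by linarith [(hab i hi).2.2])
  have hmono : ∀ i j, i < j → j < N → √(b i - c) ≤ √(a j - c) := fun i j hij hj =>
    Real.sqrt_le_sqrt (by linarith [hord i j hij hj])
  have hpre : ∀ i < N, ∀ x : ℝ, (a i < x ^ 2 + c ∧ x ^ 2 + c < b i) ↔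
      (-√(b i - c) < x ∧ x < -√(a i - c)) ∨ (√(a i - c) < x ∧ x < √(b i - c)) := by
    intro i hi x
    obtain ⟨h1, h2, h3⟩ := hab i hi
    have ha : a i < x ^ 2 + c ↔ √(a i - c) < |x| := by
      rw [← Real.sqrt_sq_eq_abs, Real.sqrt_lt_sqrt_iff (by linarith), sub_lt_iff_lt_add]
    have hb : x ^ 2 + c < b i ↔ |x| < √(b i - c) := by
      rw [← Real.sqrt_sq_eq_abs, Real.sqrt_lt_sqrt_iff (sq_nonneg x), lt_sub_iff_add_lt]
    rw [ha, hb, lt_abs, abs_lt]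
    have := Real.sqrt_nonneg (a i - c)
    have := hlt i hi
    constructor
    · rintro ⟨h | h, h4, h5⟩
      · exact Or.inr ⟨h, h5⟩
      · exact Or.inl ⟨h4, by linarith⟩
    · rintro (⟨h4, h5⟩ | ⟨h4, h5⟩)
      · exact ⟨Or.inr (by linarith), h4, by linarith⟩
      · exact ⟨Or.inl h4, by linarith, h5⟩
  refine ⟨fun i => if i < N then -√(b (N - 1 - i) - c) else √(a (i - N) - c),
    fun i => if i < N then -√(a (N - 1 - i) - c) else √(b (i - N) - c), ?_, ?_, ?_⟩
  · intro i hi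
    by_cases h : i < N
    · have hk : N - 1 - i < N := by omega
      simp only [h, if_true]
      refine ⟨by linarith [hle _ hk], by linarith [hlt _ hk], ?_⟩
      linarith [Real.sqrt_nonneg (a (N - 1 - i) - c)]
    · have hk : i - N < N := by omega
      simp only [h, if_false]
      exact ⟨by linarith [Real.sqrt_nonneg (a (i - N) - c)], hlt _ hk, hle _ hk⟩
  · intro i j hij hj
    by_cases h : j < N
    · have hi : i < N := by omega
      simp only [h, hi, if_true]
      exact neg_le_neg (hmono _ _ (by omega) (by omega))
    · by_cases hi : i < N
      · simp only [h, hi, if_true, if_false]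
        linarith [Real.sqrt_nonneg (a (N - 1 - i) - c), Real.sqrt_nonneg (a (j - N) - c)]
      · simp only [h, hi, if_false]
        exact hmono _ _ (by omega) (by omega)
  · intro x
    rw [hT, hS]
    constructor
    · rintro ⟨i, hi, hx⟩
      rcases (hpre i hi x).1 hx with h | h
      · refine ⟨N - 1 - i, by omega, ?_⟩
        have hlt' : N - 1 - i < N := by omega
        have heq : N - 1 - (N - 1 - i) = i := by omega
        simpa only [hlt', if_true, heq] using h
      · refine ⟨N + i, by omega, ?_⟩
        have hnlt : ¬ N + i < N := by omega
        simpa only [hnlt, if_false, Nat.add_sub_cancel_left] using h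
    · rintro ⟨i, hi, hx⟩
      by_cases h : i < N
      · simp only [h, if_true] at hx
        exact ⟨N - 1 - i, by omega, (hpre _ (by omega) x).2 (Or.inl hx)⟩
      · simp only [h, if_false] at hx
        exact ⟨i - N, by omega, (hpre _ (by omega) x).2 (Or.inr hx)⟩

/-- Orbits of `x ↦ x ^ 2 + c` never return to `[-p, p]` after leaving it, where `p` is a
fixed point. -/
theorem abs_le_of_abs_iterate_le {p c : ℝ} (hp : 0 ≤ p) (hfix : p ^ 2 + c = p) (n : ℕ) (x : ℝ)
    (h : |(fun y : ℝ => y ^ 2 + c)^[n] x| ≤ p) : |x| ≤ p := by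
  induction n generalizing x with
  | zero => exact h
  | succ n ih =>
    have hx := (abs_le.1 (ih _ h)).2
    exact abs_le_of_sq_le_sq (by linarith) hp

/-- For every `c < -2` and every `n ≥ 0`, the set `Aₙ` is a disjoint union of exactly
`2^n` nonempty open intervals.  Here `A 0 = {x ∈ I : F_c x < -p}` and for `n ≥ 1`,
`A n = {x ∈ I : F_c^[n] x ∈ A 0}`. -/
theorem stmt5 (c : ℝ) (hc : c < -2) (p : ℝ) (hp : p = (1 + Real.sqrt (1 - 4*c)) / 2)
    (A : ℕ → Set ℝ)
    (hA0 : A 0 = {x ∈ Set.Icc (-p) p | x^2 + c < -p})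
    (hAn : ∀ n : ℕ, 1 ≤ n →
      A n = {x ∈ Set.Icc (-p) p | (fun y : ℝ => y^2 + c)^[n] x ∈ A 0})
    (n : ℕ) :
    ∃ a b : Fin (2^n) → ℝ, (∀ i, a i < b i) ∧ (∀ i j, i < j → b i ≤ a j) ∧
      A n = ⋃ i, Set.Ioo (a i) (b i) := by
  have hs : 3 < √(1 - 4 * c) := Real.lt_sqrt_of_sq_lt (by linarith)
  have hsq : √(1 - 4 * c) ^ 2 = 1 - 4 * c := Real.sq_sqrt (by linarith)
  have hp2 : 2 < p := by linarith
  have hfix : p ^ 2 + c = p := by rw [hp]; linarith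
  have hpc : 0 < -p - c := by nlinarith
  have hp0 : 0 ≤ p := by linarith
  have hA : ∀ n x, x ∈ A n ↔ (fun y : ℝ => y ^ 2 + c)^[n] x ∈ A 0 := by
    intro n x
    rcases Nat.eq_zero_or_pos n with rfl | hn
    · rfl
    · rw [hAn n hn]
      refine ⟨fun h => h.2, fun h => ⟨?_, h⟩⟩
      rw [hA0] at h
      exact abs_le.1 (abs_le_of_abs_iterate_le hp0 hfix n x (abs_le.2 h.1))
  have key : ∀ n, IsUnionOfIntervals p (2 ^ n) (A n) := by
    intro n
    induction n with
    | zero =>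
      have hr : √(-p - c) ≤ p := (Real.sqrt_le_left hp0).2 (by linarith)
      have hr0 := Real.sqrt_pos.2 hpc
      refine ⟨fun _ => -√(-p - c), fun _ => √(-p - c), fun _ _ => ⟨?_, ?_, hr⟩, ?_, ?_⟩
      · linarith
      · linarith
      · intro i j hij hj
        omega
      · intro x
        have hx : x ^ 2 + c < -p ↔ -√(-p - c) < x ∧ x < √(-p - c) := by
          rw [← Real.sq_lt, lt_sub_iff_add_lt]
        rw [hA0]
        constructor
        · exact fun h => ⟨0, by norm_num, hx.1 h.2⟩
        · rintro ⟨_, _, h⟩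
          exact ⟨⟨by linarith [h.1], by linarith [h.2]⟩, hx.2 h⟩
    | succ n ih =>
      rw [pow_succ']
      refine ih.preimage hp0 hfix hpc fun x => ?_
      rw [hA, hA n, Function.iterate_succ_apply]
  obtain ⟨a, b, hab, hord, hS⟩ := key n
  refine ⟨fun i => a i, fun i => b i, fun i => (hab i i.2).2.1,
    fun i j hij => hord i j hij j.2, ?_⟩
  ext x
  rw [hS, Set.mem_iUnion]
  exact ⟨fun ⟨i, hi, h⟩ => ⟨⟨i, hi⟩, h⟩, fun ⟨i, h⟩ => ⟨i, i.2, h⟩⟩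
end

section
/- For every c < −2 and every n ≥ 0, the set I \ (A₀ ∪ A₁ ∪ … ∪ Aₙ) is a disjoint union of exactly 2^{n+1} nondegenerate closed intervals, and the iterate F_c^{n+1} maps each of these closed intervals onto the full interval I = [−p, p]. -/
/-- The right inverse branch of `y ↦ y ^ 2 + c` maps `[a, b]` to an interval that is
mapped back onto `[a, b]`. -/
theorem image_sq_add_Icc_sqrt {c a b : ℝ} (ha : c ≤ a) (hb : a ≤ b) :
    (fun y : ℝ => y ^ 2 + c) '' Set.Icc (√(a - c)) (√(b - c)) = Set.Icc a b := by
  ext y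
  constructor
  · rintro ⟨x, ⟨h1, h2⟩, rfl⟩
    have hx : 0 ≤ x := (Real.sqrt_nonneg _).trans h1
    have h3 := (Real.sqrt_le_left hx).1 h1
    have h4 := (Real.le_sqrt hx (by linarith)).1 h2
    exact ⟨by linarith, by linarith⟩
  · rintro ⟨h1, h2⟩
    refine ⟨√(y - c), ⟨Real.sqrt_le_sqrt (by linarith), Real.sqrt_le_sqrt (by linarith)⟩, ?_⟩
    simp only
    rw [Real.sq_sqrt (by linarith)]
    ring

/-- The left inverse branch of `y ↦ y ^ 2 + c` maps `[a, b]` to an interval that is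
mapped back onto `[a, b]`. -/
theorem image_sq_add_Icc_neg_sqrt {c a b : ℝ} (ha : c ≤ a) (hb : a ≤ b) :
    (fun y : ℝ => y ^ 2 + c) '' Set.Icc (-√(b - c)) (-√(a - c)) = Set.Icc a b := by
  rw [← image_sq_add_Icc_sqrt ha hb, ← Set.image_neg_Icc, Set.image_image]
  simp only [neg_sq]

theorem sq_add_mem_Icc_iff {c a b x : ℝ} (ha : c ≤ a) (hb : a ≤ b) :
    x ^ 2 + c ∈ Set.Icc a b ↔
      x ∈ Set.Icc (-√(b - c)) (-√(a - c)) ∨ x ∈ Set.Icc (√(a - c)) (√(b - c)) := by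
  constructor
  · rintro ⟨h1, h2⟩
    have h3 : √(a - c) ≤ |x| := Real.sqrt_le_iff.2 ⟨abs_nonneg x, by rw [sq_abs]; linarith⟩
    have h4 : |x| ≤ √(b - c) := Real.le_sqrt_of_sq_le (by rw [sq_abs]; linarith)
    rcases abs_cases x with ⟨h, -⟩ | ⟨h, -⟩
    · exact Or.inr ⟨h ▸ h3, h ▸ h4⟩
    · exact Or.inl ⟨by linarith, by linarith⟩
  · rintro (h | h)
    · exact image_sq_add_Icc_neg_sqrt ha hb ▸ Set.mem_image_of_mem _ h
    · exact image_sq_add_Icc_sqrt ha hb ▸ Set.mem_image_of_mem _ h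

/-- An ordered family of `N` disjoint intervals lying to the right of the critical value `c`
pulls back under `y ↦ y ^ 2 + c` to an ordered family of `N + N` disjoint intervals, each of which
is mapped onto one of the original intervals. -/
theorem exists_Icc_preimage_sq_add {c : ℝ} {N : ℕ} {a b : Fin N → ℝ} (hc : ∀ i, c < a i)
    (hab : ∀ i, a i < b i) (hlt : ∀ i j, i < j → b i < a j) :
    ∃ a' b' : Fin (N + N) → ℝ, (∀ i, a' i < b' i) ∧ (∀ i j, i < j → b' i < a' j) ∧
      ((fun y : ℝ => y ^ 2 + c) ⁻¹' (⋃ i, Set.Icc (a i) (b i)) = ⋃ i, Set.Icc (a' i) (b' i)) ∧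
      ∀ i, ∃ j, (fun y : ℝ => y ^ 2 + c) '' Set.Icc (a' i) (b' i) = Set.Icc (a j) (b j) := by
  have hpos : ∀ i, 0 < √(a i - c) := fun i => Real.sqrt_pos.2 (sub_pos.2 (hc i))
  have hsab : ∀ i, √(a i - c) < √(b i - c) := fun i =>
    Real.sqrt_lt_sqrt (by linarith [hc i]) (by linarith [hab i])
  have hsba : ∀ i j, i < j → √(b i - c) < √(a j - c) := fun i j h =>
    Real.sqrt_lt_sqrt (by linarith [hc i, hab i]) (by linarith [hlt i j h])
  refine ⟨Fin.append (fun i => -√(b i.rev - c)) (fun i => √(a i - c)),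
    Fin.append (fun i => -√(a i.rev - c)) (fun i => √(b i - c)), ?_, ?_, ?_, ?_⟩
  · intro i
    induction i using Fin.addCases with
    | left i => simpa using hsab i.rev
    | right i => simpa only [Fin.append_right] using hsab i
  · intro i j hij
    induction i using Fin.addCases with
    | left i =>
      induction j using Fin.addCases with
      | left j =>
        simp only [Fin.append_left, neg_lt_neg_iff]
        exact hsba _ _ (Fin.rev_lt_rev.2 hij)
      | right j =>
        simp only [Fin.append_left, Fin.append_right]
        linarith [hpos i.rev, hpos j]
    | right i =>
      induction j using Fin.addCases with
      | left j =>
        simp only [Fin.lt_def, Fin.val_natAdd, Fin.val_castAdd] at hij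
        omega
      | right j =>
        simp only [Fin.append_right]
        exact hsba _ _ (Fin.lt_def.2 (Nat.add_lt_add_iff_left.1 (Fin.lt_def.1 hij)))
  · ext x
    simp only [Set.mem_preimage, Set.mem_iUnion]
    constructor
    · rintro ⟨i, hi⟩
      rcases (sq_add_mem_Icc_iff (hc i).le (hab i).le).1 hi with h | h
      · exact ⟨Fin.castAdd N i.rev, by simpa using h⟩
      · exact ⟨Fin.natAdd N i, by simpa only [Fin.append_right] using h⟩
    · rintro ⟨i, hi⟩
      induction i using Fin.addCases with
      | left i =>
        rw [Fin.append_left, Fin.append_left] at hi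
        exact ⟨i.rev, (sq_add_mem_Icc_iff (hc _).le (hab _).le).2 (Or.inl hi)⟩
      | right i =>
        rw [Fin.append_right, Fin.append_right] at hi
        exact ⟨i, (sq_add_mem_Icc_iff (hc _).le (hab _).le).2 (Or.inr hi)⟩
  · intro i
    induction i using Fin.addCases with
    | left i =>
      rw [Fin.append_left, Fin.append_left]
      exact ⟨i.rev, image_sq_add_Icc_neg_sqrt (hc _).le (hab _).le⟩
    | right i =>
      rw [Fin.append_right, Fin.append_right]
      exact ⟨i, image_sq_add_Icc_sqrt (hc _).le (hab _).le⟩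

theorem mem_Icc_of_sq_add_mem_Icc {c p : ℝ} (hp : 2 < p) (hfix : p ^ 2 + c = p) {x : ℝ}
    (hx : x ^ 2 + c ∈ Set.Icc (-p) p) :
    x ∈ Set.Icc (-p) p :=
  abs_le.1 (abs_le_of_sq_le_sq (by linarith [hx.2]) (by linarith))

theorem mem_Icc_of_iterate_sq_add_mem_Icc {c p : ℝ} (hp : 2 < p) (hfix : p ^ 2 + c = p)
    (k : ℕ) {x : ℝ} (hx : (fun y : ℝ => y ^ 2 + c)^[k] x ∈ Set.Icc (-p) p) : x ∈ Set.Icc (-p) p := by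
  induction k with
  | zero => exact hx
  | succ k ih =>
    rw [Function.iterate_succ_apply'] at hx
    exact ih (mem_Icc_of_sq_add_mem_Icc hp hfix hx)

theorem exists_Icc_preimage_iterate_sq_add {c p : ℝ} (hp : 2 < p) (hfix : p ^ 2 + c = p)
    (k : ℕ) :
    ∃ a b : Fin (2 ^ k) → ℝ, (∀ i, a i < b i) ∧ (∀ i j, i < j → b i < a j) ∧
      ((fun y : ℝ => y ^ 2 + c)^[k] ⁻¹' Set.Icc (-p) p = ⋃ i, Set.Icc (a i) (b i)) ∧
      ∀ i, (fun y : ℝ => y ^ 2 + c)^[k] '' Set.Icc (a i) (b i) = Set.Icc (-p) p := by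
  induction k with
  | zero =>
    refine ⟨fun _ => -p, fun _ => p, fun _ => by linarith, fun i j h => ?_, ?_, ?_⟩
    · simp only [Fin.lt_def] at h
      omega
    · simp [Set.iUnion_const]
    · simp
  | succ k ih =>
    obtain ⟨a, b, hab, hlt, hpre, himg⟩ := ih
    have hc : ∀ i, c < a i := fun i => by
      have hmem : a i ∈ (fun y : ℝ => y ^ 2 + c)^[k] ⁻¹' Set.Icc (-p) p :=
        hpre ▸ Set.mem_iUnion.2 ⟨i, Set.left_mem_Icc.2 (hab i).le⟩
      have := (mem_Icc_of_iterate_sq_add_mem_Icc hp hfix k hmem).1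
      nlinarith
    rw [pow_succ, mul_two]
    obtain ⟨a', b', hab', hlt', hpre', himg'⟩ := exists_Icc_preimage_sq_add hc hab hlt
    refine ⟨a', b', hab', hlt', ?_, fun i => ?_⟩
    · rw [Function.iterate_succ, Set.preimage_comp, hpre, hpre']
    · obtain ⟨j, hj⟩ := himg' i
      rw [Function.iterate_succ, Set.image_comp, hj, himg]

theorem Icc_diff_biUnion_eq_preimage_iterate_sq_add {c p : ℝ} (hp : 2 < p)
    (hfix : p ^ 2 + c = p) {A : ℕ → Set ℝ}
    (hA : ∀ k, A k = {x ∈ Set.Icc (-p) p | (fun y : ℝ => y ^ 2 + c)^[k] x ∈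
      {y ∈ Set.Icc (-p) p | y ^ 2 + c < -p}}) (k : ℕ) :
    Set.Icc (-p) p \ ⋃ m ∈ Finset.range k, A m =
      (fun y : ℝ => y ^ 2 + c)^[k] ⁻¹' Set.Icc (-p) p := by
  induction k with
  | zero => simp
  | succ k ih =>
    rw [Finset.range_add_one, Finset.set_biUnion_insert, Set.union_comm, ← Set.sdiff_sdiff, ih, hA]
    ext x
    simp only [Set.mem_sdiff, Set.mem_preimage, Set.mem_ofPred_eq, Function.iterate_succ_apply']
    constructor
    · rintro ⟨h1, h2⟩
      have hx := mem_Icc_of_iterate_sq_add_mem_Icc hp hfix k h1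
      refine ⟨not_lt.1 fun h => h2 ⟨hx, h1, h⟩, ?_⟩
      have := sq_le_sq' h1.1 h1.2
      linarith
    · intro h
      exact ⟨mem_Icc_of_sq_add_mem_Icc hp hfix h, fun h2 => absurd h.1 (not_le.2 h2.2.2)⟩


/-- For every `c < -2` and every `n ≥ 0`, the set `I \ (A₀ ∪ ⋯ ∪ Aₙ)` is a disjoint
union of exactly `2^(n+1)` nondegenerate closed intervals, and `F_c^[n+1]` maps each
of these closed intervals onto the full interval `I = [-p, p]`. -/
theorem stmt6 (c : ℝ) (hc : c < -2) (p : ℝ) (hp : p = (1 + Real.sqrt (1 - 4*c)) / 2)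
    (A : ℕ → Set ℝ)
    (hA0 : A 0 = {x ∈ Set.Icc (-p) p | x^2 + c < -p})
    (hAn : ∀ n : ℕ, 1 ≤ n →
      A n = {x ∈ Set.Icc (-p) p | (fun y : ℝ => y^2 + c)^[n] x ∈ A 0})
    (n : ℕ) :
    ∃ a b : Fin (2^(n+1)) → ℝ, (∀ i, a i < b i) ∧ (∀ i j, i < j → b i < a j) ∧
      (Set.Icc (-p) p \ ⋃ m ∈ Finset.range (n+1), A m = ⋃ i, Set.Icc (a i) (b i)) ∧
      (∀ i, (fun y : ℝ => y^2 + c)^[n+1] '' Set.Icc (a i) (b i) = Set.Icc (-p) p) := by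
  have hsq : Real.sqrt (1 - 4 * c) ^ 2 = 1 - 4 * c := Real.sq_sqrt (by linarith)
  have hp2 : 2 < p := by
    have : 3 < Real.sqrt (1 - 4 * c) := Real.lt_sqrt_of_sq_lt (by linarith)
    linarith
  have hfix : p ^ 2 + c = p := by
    rw [hp]
    linarith
  have hA : ∀ k, A k = {x ∈ Set.Icc (-p) p | (fun y : ℝ => y ^ 2 + c)^[k] x ∈
      {y ∈ Set.Icc (-p) p | y ^ 2 + c < -p}} := by
    intro k
    rcases Nat.eq_zero_or_pos k with rfl | hk
    · rw [hA0]
      ext x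
      simp +contextual
    · rw [hAn k hk, hA0]
  rw [Icc_diff_biUnion_eq_preimage_iterate_sq_add hp2 hfix hA]
  exact exists_Icc_preimage_iterate_sq_add hp2 hfix (n + 1)
end

section
/- Suppose c < −2 and there exists λ > 1 such that |F_c'(x)| = |2x| > λ for all x ∈ I \ A₀. Then Λ_c = {x ∈ I : F_cⁿ(x) ∈ I for all n ≥ 0} is a Cantor set, i.e. it is nonempty, compact, perfect, and totally disconnected. -/
/-- The map `x ↦ x² + c` expands distances by at least `lam` between points of the same sign
whose derivatives exceed `lam` in absolute value. -/
lemma mul_abs_sub_le_abs_sq_add_sub (c lam x y : ℝ) (hx : lam < |2 * x|)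
    (hy : lam < |2 * y|) (hxy : 0 < x * y) :
    lam * |x - y| ≤ |(x ^ 2 + c) - (y ^ 2 + c)| := by
  have h : (x ^ 2 + c) - (y ^ 2 + c) = (x + y) * (x - y) := by ring
  rw [h, abs_mul]
  refine mul_le_mul_of_nonneg_right ?_ (abs_nonneg _)
  rw [abs_mul, abs_two] at hx hy
  have h2 : |x + y| = |x| + |y| := by
    rw [abs_add_eq_add_abs_iff]
    rcases pos_and_pos_or_neg_and_neg_of_mul_pos hxy with h | h
    · exact Or.inl ⟨h.1.le, h.2.le⟩
    · exact Or.inr ⟨h.1.le, h.2.le⟩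
  rw [h2]
  linarith

/-- If `lam > 1` and `a ≤ C / lam ^ n` for all `n`, then `a ≤ 0`. -/
lemma nonpos_of_forall_le_div_pow (a C lam : ℝ) (hlam : 1 < lam)
    (h : ∀ n : ℕ, a ≤ C / lam ^ n) : a ≤ 0 :=
  ge_of_tendsto' ((tendsto_pow_atTop_atTop_of_one_lt hlam).const_div_atTop C) h

/-- A subset of `[-p, p]` that is closed under inverse branches of an expanding quadratic map and
avoids the critical point has, arbitrarily close to each of its points, other points. -/
lemma exists_ne_abs_sub_le_div_pow (c p lam : ℝ) (hlam : 1 < lam) (hp0 : 0 < p)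
    (hfix : p ^ 2 + c = p) (hcp : c < -p) (S : Set ℝ)
    (hS : ∀ x, x ∈ S ↔ x ∈ Set.Icc (-p) p ∧ x ^ 2 + c ∈ S)
    (hexp : ∀ x ∈ S, lam < |2 * x|) (n : ℕ) :
    ∀ x ∈ S, ∃ y ∈ S, y ≠ x ∧ |y - x| ≤ 2 * p / lam ^ n := by
  have hl0 : 0 < lam := by linarith
  have hne : ∀ x ∈ S, x ≠ 0 := by
    rintro x hx rfl
    have := hexp 0 hx
    simp at this
    linarith
  induction n with
  | zero =>
    intro x hx
    have h := (hS x).1 hx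
    have hI := h.1
    refine ⟨-x, (hS _).2 ⟨⟨by linarith [hI.2], by linarith [hI.1]⟩, by simpa using h.2⟩, ?_, ?_⟩
    · intro h0
      exact hne x hx (by linarith)
    · simp only [pow_zero, div_one]
      rw [abs_le]
      constructor <;> linarith [hI.1, hI.2]
  | succ n ih =>
    intro x hx
    have h := (hS x).1 hx
    obtain ⟨w, hw, hwx, hd⟩ := ih _ h.2
    have hwI := ((hS w).1 hw).1
    have hpos : 0 < w - c := by linarith [hwI.1]
    obtain ⟨y, hy2, hxy⟩ : ∃ y : ℝ, y ^ 2 = w - c ∧ 0 < y * x := by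
      have hs := Real.sqrt_pos.2 hpos
      rcases lt_or_gt_of_ne (hne x hx) with h0 | h0
      · exact ⟨-√(w - c), by rw [neg_sq, Real.sq_sqrt hpos.le],
          mul_pos_of_neg_of_neg (by linarith) h0⟩
      · exact ⟨√(w - c), Real.sq_sqrt hpos.le, mul_pos hs h0⟩
    have hyw : y ^ 2 + c = w := by linarith
    have hyS : y ∈ S := by
      refine (hS y).2 ⟨?_, hyw ▸ hw⟩
      exact abs_le.1 (abs_le_of_sq_le_sq (by linarith [hwI.2]) hp0.le)
    refine ⟨y, hyS, ?_, ?_⟩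
    · rintro rfl
      exact hwx hyw.symm
    · have hm := mul_abs_sub_le_abs_sq_add_sub c lam y x (hexp y hyS) (hexp x hx) hxy
      rw [hyw] at hm
      rw [pow_succ, ← div_div, le_div_iff₀ hl0]
      linarith

/-- A preconnected subset of a forward invariant set on which `x ↦ x² + c` is expanding
has diameter at most `2 * p / lam ^ n`. -/
lemma IsPreconnected.abs_sub_le_div_pow (c p lam : ℝ) (hlam : 1 < lam) (S : Set ℝ)
    (hS : ∀ x ∈ S, x ∈ Set.Icc (-p) p ∧ x ^ 2 + c ∈ S)
    (hexp : ∀ x ∈ S, lam < |2 * x|) (n : ℕ) :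
    ∀ t ⊆ S, IsPreconnected t → ∀ x ∈ t, ∀ y ∈ t, |x - y| ≤ 2 * p / lam ^ n := by
  have hl0 : 0 < lam := by linarith
  have hne : (0 : ℝ) ∉ S := by
    intro hx
    have := hexp 0 hx
    simp at this
    linarith
  induction n with
  | zero =>
    intro t ht _ x hx y hy
    have h1 := (hS x (ht hx)).1
    have h2 := (hS y (ht hy)).1
    simp only [pow_zero, div_one]
    rw [abs_le]
    constructor <;> linarith [h1.1, h1.2, h2.1, h2.2]
  | succ n ih =>
    intro t ht hc x hx y hy
    have hxy : 0 < x * y := by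
      by_contra! h
      rcases mul_nonpos_iff.1 h with h | h
      · exact hne (ht (hc.ordConnected.out hy hx ⟨h.2, h.1⟩))
      · exact hne (ht (hc.ordConnected.out hx hy h))
    have hm := mul_abs_sub_le_abs_sq_add_sub c lam x y (hexp x (ht hx)) (hexp y (ht hy)) hxy
    have hi := ih ((fun x : ℝ => x ^ 2 + c) '' t)
      (Set.image_subset_iff.2 fun z hz => (hS z (ht hz)).2)
      (hc.image _ (by fun_prop)) _ (Set.mem_image_of_mem _ hx) _ (Set.mem_image_of_mem _ hy)
    rw [pow_succ, ← div_div, le_div_iff₀ hl0]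
    linarith


/-- Suppose `c < -2` and there exists `λ > 1` with `|2x| > λ` for all `x ∈ I \ A₀`.
Then `Λ_c = {x ∈ I : F_c^[n] x ∈ I for all n}` is a Cantor set: nonempty, compact,
perfect, and totally disconnected. -/
theorem stmt7 (c : ℝ) (hc : c < -2) (p : ℝ) (hp : p = (1 + Real.sqrt (1 - 4*c)) / 2)
    (lam : ℝ) (hlam : 1 < lam)
    (hexp : ∀ x ∈ Set.Icc (-p) p \ {x ∈ Set.Icc (-p) p | x^2 + c < -p}, lam < |2*x|)
    (Λ : Set ℝ)
    (hΛ : Λ = {x ∈ Set.Icc (-p) p |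
      ∀ n : ℕ, (fun y : ℝ => y^2 + c)^[n] x ∈ Set.Icc (-p) p}) :
    Λ.Nonempty ∧ IsCompact Λ ∧ Perfect Λ ∧ IsTotallyDisconnected Λ := by
  have hsq : Real.sqrt (1 - 4 * c) ^ 2 = 1 - 4 * c := Real.sq_sqrt (by linarith)
  have hs3 : 3 < Real.sqrt (1 - 4 * c) := Real.lt_sqrt_of_sq_lt (by linarith)
  have hfix : p ^ 2 + c = p := by
    rw [hp]
    linarith
  have hp2 : 2 < p := by linarith
  have hcp : c < -p := by nlinarith
  have hS : ∀ x, x ∈ Λ ↔ x ∈ Set.Icc (-p) p ∧ x ^ 2 + c ∈ Λ := by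
    intro x
    rw [hΛ]
    constructor
    · rintro ⟨hx, h⟩
      exact ⟨hx, h 1, fun n => h (n + 1)⟩
    · rintro ⟨hx, _, h⟩
      refine ⟨hx, fun n => ?_⟩
      cases n with
      | zero => exact hx
      | succ n => exact h n
  have hexpΛ : ∀ x ∈ Λ, lam < |2 * x| := by
    intro x hx
    have h := (hS x).1 hx
    exact hexp x ⟨h.1, fun h' => absurd h'.2 (not_lt.2 ((hS _).1 h.2).1.1)⟩
  have hclosed : IsClosed Λ := by
    have : Λ = Set.Icc (-p) p ∩
        ⋂ n : ℕ, (fun y : ℝ => y ^ 2 + c)^[n] ⁻¹' Set.Icc (-p) p := by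
      rw [hΛ]
      ext x
      simp
    rw [this]
    refine isClosed_Icc.inter (isClosed_iInter fun n => isClosed_Icc.preimage ?_)
    exact Continuous.iterate (by fun_prop) n
  refine ⟨⟨p, ?_⟩, ?_, ⟨hclosed, ?_⟩, ?_⟩
  · have hpI : p ∈ Set.Icc (-p) p := ⟨by linarith, le_rfl⟩
    rw [hΛ]
    refine ⟨hpI, fun n => ?_⟩
    rw [Function.iterate_fixed hfix n]
    exact hpI
  · exact isCompact_Icc.of_isClosed_subset hclosed fun x hx => ((hS x).1 hx).1
  · intro x hx
    rw [accPt_iff_nhds]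
    intro U hU
    obtain ⟨ε, hε, hball⟩ := Metric.mem_nhds_iff.1 hU
    obtain ⟨n, hn⟩ : ∃ n : ℕ, 2 * p / lam ^ n < ε := by
      by_contra! h
      exact absurd (nonpos_of_forall_le_div_pow ε (2 * p) lam hlam h) (not_le.2 hε)
    obtain ⟨y, hy, hyx, hd⟩ := exists_ne_abs_sub_le_div_pow c p lam hlam (by linarith) hfix hcp Λ
      hS hexpΛ n x hx
    refine ⟨y, ⟨hball ?_, hy⟩, hyx⟩
    rw [Metric.mem_ball, Real.dist_eq]
    exact hd.trans_lt hn
  · intro t ht hconn x hx y hy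
    have h := nonpos_of_forall_le_div_pow |x - y| (2 * p) lam hlam fun n =>
      IsPreconnected.abs_sub_le_div_pow c p lam hlam Λ (fun z => (hS z).1) hexpΛ n t ht hconn
        x hx y hy
    exact sub_eq_zero.1 (abs_nonpos_iff.1 h)
end

section
/- Suppose c < −2 and there exists λ > 1 such that |F_c'(x)| = |2x| > λ for all x ∈ I \ A₀. Then Λ_c contains no nondegenerate interval: if x ≤ y and [x, y] ⊆ Λ_c, then x = y. Consequently Λ_c is totally disconnected. -/
/-- If a quadratic map sends a set into itself and expands by a factor `lam` there, then every
interval in the set of length `l` yields one of length at least `lam * l`. -/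
theorem exists_Icc_subset_expanded_of_quadratic {c lam : ℝ} (hlam : 0 < lam) {S : Set ℝ}
    (hexp : ∀ z ∈ S, lam < |2 * z|) (hinv : ∀ z ∈ S, z ^ 2 + c ∈ S)
    {x y : ℝ} (hxy : x ≤ y) (hS : Set.Icc x y ⊆ S) :
    ∃ x' y' : ℝ, x' ≤ y' ∧ Set.Icc x' y' ⊆ S ∧ lam * (y - x) ≤ y' - x' := by
  have h0 : (0 : ℝ) ∉ S := fun h ↦ by
    have := hexp 0 h
    norm_num at this
    linarith
  have hx := hexp x (hS ⟨le_rfl, hxy⟩)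
  have hy := hexp y (hS ⟨hxy, le_rfl⟩)
  rcases lt_or_ge 0 x with hx0 | hx0
  · rw [abs_of_pos (by linarith)] at hx hy
    refine ⟨x ^ 2 + c, y ^ 2 + c, by nlinarith, fun w hw ↦ ?_, by nlinarith⟩
    have hw0 : 0 ≤ w - c := by nlinarith [hw.1]
    have hmem : √(w - c) ∈ Set.Icc x y :=
      ⟨Real.le_sqrt_of_sq_le (by linarith [hw.1]),
        Real.sqrt_le_iff.2 ⟨by linarith, by linarith [hw.2]⟩⟩
    simpa [Real.sq_sqrt hw0] using hinv _ (hS hmem)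
  · have hy0 : y < 0 := not_le.1 fun h ↦ h0 (hS ⟨hx0, h⟩)
    rw [abs_of_neg (by linarith)] at hx hy
    refine ⟨y ^ 2 + c, x ^ 2 + c, by nlinarith, fun w hw ↦ ?_, by nlinarith⟩
    have hw0 : 0 ≤ w - c := by nlinarith [hw.1]
    have h1 : -y ≤ √(w - c) := Real.le_sqrt_of_sq_le (by nlinarith [hw.1])
    have h2 : √(w - c) ≤ -x := Real.sqrt_le_iff.2 ⟨by linarith, by nlinarith [hw.2]⟩
    have hmem : -√(w - c) ∈ Set.Icc x y := ⟨by linarith, by linarith⟩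
    simpa [Real.sq_sqrt hw0] using hinv _ (hS hmem)


/-- Suppose `c < -2` and there exists `λ > 1` with `|2x| > λ` for all `x ∈ I \ A₀`.
Then `Λ_c` contains no nondegenerate interval: if `x ≤ y` and `[x, y] ⊆ Λ_c` then
`x = y`.  Consequently `Λ_c` is totally disconnected. -/
theorem stmt8 (c : ℝ) (hc : c < -2) (p : ℝ) (hp : p = (1 + Real.sqrt (1 - 4*c)) / 2)
    (lam : ℝ) (hlam : 1 < lam)
    (hexp : ∀ x ∈ Set.Icc (-p) p \ {x ∈ Set.Icc (-p) p | x^2 + c < -p}, lam < |2*x|)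
    (Λ : Set ℝ)
    (hΛ : Λ = {x ∈ Set.Icc (-p) p |
      ∀ n : ℕ, (fun y : ℝ => y^2 + c)^[n] x ∈ Set.Icc (-p) p}) :
    (∀ x y : ℝ, x ≤ y → Set.Icc x y ⊆ Λ → x = y) ∧ IsTotallyDisconnected Λ := by
  have hinv : ∀ z ∈ Λ, z ^ 2 + c ∈ Λ := by
    subst hΛ
    exact fun z hz ↦ ⟨hz.2 1, fun n ↦ hz.2 (n + 1)⟩
  have hexpΛ : ∀ z ∈ Λ, lam < |2 * z| := by
    subst hΛ
    exact fun z hz ↦ hexp z ⟨hz.1, fun h ↦ absurd (hz.2 1).1 (not_le.2 h.2)⟩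
  have hsub : Λ ⊆ Set.Icc (-p) p := hΛ ▸ fun z hz ↦ hz.1
  have hbound : ∀ n : ℕ, ∀ x y : ℝ, x ≤ y → Set.Icc x y ⊆ Λ → lam ^ n * (y - x) ≤ 2 * p := by
    intro n
    induction n with
    | zero =>
      intro x y hxy h
      have h1 := (hsub (h ⟨le_rfl, hxy⟩)).1
      have h2 := (hsub (h ⟨hxy, le_rfl⟩)).2
      linarith
    | succ n ih =>
      intro x y hxy h
      obtain ⟨x', y', hxy', h', hle⟩ :=
        exists_Icc_subset_expanded_of_quadratic (by linarith) hexpΛ hinv hxy h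
      calc lam ^ (n + 1) * (y - x) = lam ^ n * (lam * (y - x)) := by ring
        _ ≤ lam ^ n * (y' - x') := by gcongr
        _ ≤ 2 * p := ih x' y' hxy' h'
  have hmain : ∀ x y : ℝ, x ≤ y → Set.Icc x y ⊆ Λ → x = y := by
    intro x y hxy h
    by_contra hne
    have hpos : 0 < y - x := sub_pos.2 (lt_of_le_of_ne hxy hne)
    obtain ⟨n, hn⟩ := pow_unbounded_of_one_lt (2 * p / (y - x)) hlam
    exact absurd (hbound n x y hxy h) (not_le.2 ((div_lt_iff₀ hpos).1 hn))
  refine ⟨hmain, fun t ht hconn x hx y hy ↦ ?_⟩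
  rcases le_total x y with hxy | hxy
  · exact hmain x y hxy ((hconn.Icc_subset hx hy).trans ht)
  · exact (hmain y x hxy ((hconn.Icc_subset hy hx).trans ht)).symm
end

section
/- Suppose c < −2 and there exists λ > 1 such that |F_c'(x)| = |2x| > λ for all x ∈ I \ A₀. Then Λ_c is perfect: it is closed and every point x ∈ Λ_c is a limit point of Λ_c (every open interval containing x contains a point of Λ_c different from x). -/
/-- A point `z` near `x ^ 2 + c` has a preimage under `y ↦ y ^ 2 + c` on the same side of `0` as `x`,
closer to `x` by a factor `lam`, provided both preimages satisfy `lam < |2 * y|`. -/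
theorem exists_preimage_sq_add_const {c lam x z : ℝ} (hz : c ≤ z) (hx : lam < |2 * x|)
    (hy : ∀ y : ℝ, y ^ 2 + c = z → lam < |2 * y|) :
    ∃ y : ℝ, y ^ 2 + c = z ∧ |y - x| * lam ≤ |z - (x ^ 2 + c)| := by
  have hs : Real.sqrt (z - c) ^ 2 = z - c := Real.sq_sqrt (by linarith)
  have hs0 := Real.sqrt_nonneg (z - c)
  obtain ⟨y, hyz, hsign⟩ : ∃ y : ℝ, y ^ 2 + c = z ∧ (0 ≤ x ∧ 0 ≤ y ∨ x ≤ 0 ∧ y ≤ 0) := by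
    rcases le_total 0 x with h | h
    · exact ⟨Real.sqrt (z - c), by linarith, Or.inl ⟨h, hs0⟩⟩
    · exact ⟨-Real.sqrt (z - c), by rw [neg_sq]; linarith, Or.inr ⟨h, by linarith⟩⟩
  refine ⟨y, hyz, ?_⟩
  have hy' := hy y hyz
  have hsum : lam ≤ |y + x| := by
    rcases hsign with ⟨h1, h2⟩ | ⟨h1, h2⟩
    · rw [abs_of_nonneg (by linarith)] at hx hy' ⊢
      linarith
    · rw [abs_of_nonpos (by linarith)] at hx hy' ⊢
      linarith
  calc |y - x| * lam ≤ |y - x| * |y + x| := by gcongr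
    _ = |z - (x ^ 2 + c)| := by rw [← abs_mul, ← hyz]; congr 1; ring


/-- Suppose `c < -2` and there exists `λ > 1` with `|2x| > λ` for all `x ∈ I \ A₀`.
Then `Λ_c` is perfect: it is closed and every point of `Λ_c` is a limit point of `Λ_c`
(every open interval containing `x` contains a point of `Λ_c` different from `x`). -/
theorem stmt9 (c : ℝ) (hc : c < -2) (p : ℝ) (hp : p = (1 + Real.sqrt (1 - 4*c)) / 2)
    (lam : ℝ) (hlam : 1 < lam)
    (hexp : ∀ x ∈ Set.Icc (-p) p \ {x ∈ Set.Icc (-p) p | x^2 + c < -p}, lam < |2*x|)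
    (Λ : Set ℝ)
    (hΛ : Λ = {x ∈ Set.Icc (-p) p |
      ∀ n : ℕ, (fun y : ℝ => y^2 + c)^[n] x ∈ Set.Icc (-p) p}) :
    IsClosed Λ ∧
    ∀ x ∈ Λ, ∀ u v : ℝ, u < x → x < v → ∃ y ∈ Λ, y ∈ Set.Ioo u v ∧ y ≠ x := by
  have hs : Real.sqrt (1 - 4 * c) ^ 2 = 1 - 4 * c := Real.sq_sqrt (by linarith)
  have hs3 : 3 < Real.sqrt (1 - 4 * c) := Real.lt_sqrt_of_sq_lt (by linarith)
  have hp2 : 2 < p := by linarith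
  have hpfix : p ^ 2 + c = p := by rw [hp]; linarith
  have hcp : c < -p := by nlinarith
  have mem_iff (x : ℝ) : x ∈ Λ ↔ ∀ n : ℕ, (fun y : ℝ => y^2 + c)^[n] x ∈ Set.Icc (-p) p := by
    rw [hΛ]
    exact ⟨fun h => h.2, fun h => ⟨h 0, h⟩⟩
  have mem_iff_image (x : ℝ) : x ∈ Λ ↔ x ∈ Set.Icc (-p) p ∧ x ^ 2 + c ∈ Λ := by
    rw [mem_iff, mem_iff]
    refine ⟨fun h => ⟨h 0, fun n => h (n + 1)⟩, ?_⟩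
    rintro ⟨h0, h⟩ (_ | n)
    exacts [h0, h n]
  have exp_of_mem {x : ℝ} (hx : x ∈ Λ) : lam < |2 * x| := by
    obtain ⟨h0, h1⟩ := (mem_iff_image x).1 hx
    exact hexp x ⟨h0, fun h => absurd h.2 (not_lt.2 ((mem_iff_image _).1 h1).1.1)⟩
  have mem_of_image {y : ℝ} (hy : y ^ 2 + c ∈ Λ) : y ∈ Λ := by
    refine (mem_iff_image y).2 ⟨abs_le.1 (abs_le_of_sq_le_sq ?_ (by linarith)), hy⟩
    linarith [((mem_iff_image _).1 hy).1.2]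
  have p_mem : p ∈ Λ := by
    rw [mem_iff]
    intro n
    rw [Function.iterate_fixed (f := fun y : ℝ => y^2 + c) hpfix]
    constructor <;> linarith
  have neg_p_mem : -p ∈ Λ := mem_of_image (by rwa [neg_sq, hpfix])
  have approx (n : ℕ) : ∀ x ∈ Λ, ∃ y ∈ Λ, y ≠ x ∧ |y - x| * lam ^ n ≤ 2 * p := by
    induction n with
    | zero =>
      intro x hx
      obtain ⟨y, hy, hyx⟩ : ∃ y ∈ Λ, y ≠ x := by
        by_cases h : p = x
        · exact ⟨-p, neg_p_mem, by rw [← h]; intro h'; linarith⟩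
        · exact ⟨p, p_mem, h⟩
      refine ⟨y, hy, hyx, ?_⟩
      have hxI := ((mem_iff_image x).1 hx).1
      have hyI := ((mem_iff_image y).1 hy).1
      rw [pow_zero, mul_one, abs_le]
      constructor <;> linarith [hxI.1, hxI.2, hyI.1, hyI.2]
    | succ n ih =>
      intro x hx
      obtain ⟨z, hz, hzx, hle⟩ := ih _ ((mem_iff_image x).1 hx).2
      obtain ⟨y, hyz, hyx⟩ := exists_preimage_sq_add_const
        (hcp.le.trans ((mem_iff_image z).1 hz).1.1) (exp_of_mem hx)
        (fun y hy => exp_of_mem (mem_of_image (hy ▸ hz)))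
      refine ⟨y, mem_of_image (hyz ▸ hz), fun h => hzx (by rw [← hyz, h]), ?_⟩
      calc |y - x| * lam ^ (n + 1) = |y - x| * lam * lam ^ n := by ring
        _ ≤ |z - (x ^ 2 + c)| * lam ^ n := by gcongr
        _ ≤ 2 * p := hle
  constructor
  · have hΛ' : Λ = ⋂ n : ℕ, (fun y : ℝ => y^2 + c)^[n] ⁻¹' Set.Icc (-p) p := by
      ext x
      simp only [mem_iff, Set.mem_iInter, Set.mem_preimage]
    rw [hΛ']
    have hcont : Continuous fun y : ℝ => y^2 + c := by fun_prop
    exact isClosed_iInter fun n => isClosed_Icc.preimage (hcont.iterate n)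
  · intro x hx u v hu hv
    obtain ⟨ε, hε, hball⟩ := Metric.mem_nhds_iff.1 (Ioo_mem_nhds hu hv)
    obtain ⟨n, hn⟩ := pow_unbounded_of_one_lt (2 * p / ε) hlam
    obtain ⟨y, hy, hyx, hle⟩ := approx n x hx
    refine ⟨y, hy, hball ?_, hyx⟩
    rw [Metric.mem_ball, Real.dist_eq]
    rw [div_lt_iff₀ hε, mul_comm (lam ^ n)] at hn
    exact lt_of_mul_lt_mul_right (hle.trans_lt hn) (by positivity)
end

section
/- Suppose c < −2 and there exists λ > 1 such that |F_c'(x)| = |2x| > λ for all x ∈ I \ A₀. Define Cₙ = {x ∈ I : F_c^m(x) ∈ I for all 0 ≤ m ≤ n}. Then for every ε > 0 there exists N such that for all n ≥ N, every connected component of Cₙ has diameter less than ε. -/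
/-- If a continuous `f` stretches by a factor of at least `r` every segment that it keeps inside
`Icc (-p) p`, then a segment whose first `n` iterates stay in `Icc (-p) p` has length `ℓ` with
`r ^ n * ℓ ≤ 2 * p`. -/
theorem pow_mul_abs_sub_le_of_uIcc_iterate_mem {f : ℝ → ℝ} (hf : Continuous f) {p r : ℝ}
    (hr : 0 ≤ r)
    (hexp : ∀ a b : ℝ, (∀ y ∈ Set.uIcc a b, y ∈ Set.Icc (-p) p ∧ f y ∈ Set.Icc (-p) p) →
      r * |b - a| ≤ |f b - f a|) (n : ℕ) :
    ∀ a b : ℝ, (∀ y ∈ Set.uIcc a b, ∀ m ≤ n, f^[m] y ∈ Set.Icc (-p) p) →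
      r ^ n * |b - a| ≤ 2 * p := by
  induction n with
  | zero =>
    intro a b h
    have ha : a ∈ Set.Icc (-p) p := h a Set.left_mem_uIcc 0 le_rfl
    have hb : b ∈ Set.Icc (-p) p := h b Set.right_mem_uIcc 0 le_rfl
    rw [pow_zero, one_mul, abs_le]
    constructor <;> linarith [ha.1, ha.2, hb.1, hb.2]
  | succ n ih =>
    intro a b h
    have hstep : r * |b - a| ≤ |f b - f a| :=
      hexp a b fun y hy => ⟨h y hy 0 (Nat.zero_le _), h y hy 1 (Nat.le_add_left 1 n)⟩
    have himage : r ^ n * |f b - f a| ≤ 2 * p := by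
      refine ih (f a) (f b) fun z hz m hm => ?_
      obtain ⟨y, hy, rfl⟩ := intermediate_value_uIcc hf.continuousOn hz
      exact h y hy (m + 1) (Nat.succ_le_succ hm)
    calc r ^ (n + 1) * |b - a| = r ^ n * (r * |b - a|) := by ring
      _ ≤ r ^ n * |f b - f a| := by gcongr
      _ ≤ 2 * p := himage


/-- Suppose `c < -2` and there exists `λ > 1` with `|2x| > λ` for all `x ∈ I \ A₀`.
Define `Cₙ = {x ∈ I : F_c^[m] x ∈ I for all 0 ≤ m ≤ n}`.  Then for every `ε > 0`
there exists `N` such that for all `n ≥ N` every connected component of `Cₙ` has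
diameter less than `ε`. -/
theorem stmt11 (c : ℝ) (hc : c < -2) (p : ℝ) (hp : p = (1 + Real.sqrt (1 - 4*c)) / 2)
    (lam : ℝ) (hlam : 1 < lam)
    (hexp : ∀ x ∈ Set.Icc (-p) p \ {x ∈ Set.Icc (-p) p | x^2 + c < -p}, lam < |2*x|)
    (C : ℕ → Set ℝ)
    (hC : ∀ n : ℕ, C n = {x ∈ Set.Icc (-p) p |
      ∀ m : ℕ, m ≤ n → (fun y : ℝ => y^2 + c)^[m] x ∈ Set.Icc (-p) p}) :
    ∀ ε : ℝ, 0 < ε → ∃ N : ℕ, ∀ n : ℕ, N ≤ n → ∀ x ∈ C n,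
      Metric.diam (connectedComponentIn (C n) x) < ε := by
  have hexpand : ∀ a b : ℝ,
      (∀ y ∈ Set.uIcc a b, y ∈ Set.Icc (-p) p ∧ y ^ 2 + c ∈ Set.Icc (-p) p) →
      lam * |b - a| ≤ |(b ^ 2 + c) - (a ^ 2 + c)| := by
    intro a b h
    have hmid : (a + b) / 2 ∈ Set.uIcc a b := by
      rw [Set.mem_uIcc]
      rcases le_total a b with hab | hab
      · left; constructor <;> linarith
      · right; constructor <;> linarith
    obtain ⟨hI, hFI⟩ := h _ hmid
    have hlt := hexp _ ⟨hI, fun hA => not_le.mpr hA.2 hFI.1⟩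
    calc lam * |b - a| ≤ |2 * ((a + b) / 2)| * |b - a| := by gcongr
      _ = |(b ^ 2 + c) - (a ^ 2 + c)| := by rw [← abs_mul]; congr 1; ring
  have hcont : Continuous fun y : ℝ => y ^ 2 + c := by fun_prop
  have hlam0 : 0 < lam := one_pos.trans hlam
  have hp0 : 0 < p := by rw [hp]; positivity
  intro ε hε
  obtain ⟨N, hN⟩ := pow_unbounded_of_one_lt (2 * p / ε) hlam
  refine ⟨N, fun n hn x _ => ?_⟩
  have hsmall : 2 * p / lam ^ n < ε := by
    rw [div_lt_comm₀ (by positivity) hε]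
    exact hN.trans_le (pow_le_pow_right₀ hlam.le hn)
  refine (Metric.diam_le_of_forall_dist_le (by positivity) fun a ha b hb => ?_).trans_lt hsmall
  rw [dist_comm, Real.dist_eq, le_div_iff₀' (by positivity)]
  refine pow_mul_abs_sub_le_of_uIcc_iterate_mem hcont hlam0.le hexpand n a b fun y hy => ?_
  have hy' : y ∈ C n := connectedComponentIn_subset _ _
    (isPreconnected_connectedComponentIn.ordConnected.uIcc_subset ha hb hy)
  rw [hC] at hy'
  exact hy'.2
end

section
/- Let F(x) = x² − 3, let p = (1 + √13)/2 be the larger fixed point of F, let I = [−p, p], and let Λ = {x ∈ I : Fⁿ(x) ∈ I for all n ≥ 0}. Then Λ is a Cantor set, Fⁿ(x) ∈ Λ for every x ∈ Λ and every n ≥ 1, and for every x ∉ Λ the sequence Fⁿ(x) diverges to infinity. In particular, there exist a Cantor set Λ ⊆ ℝ and a continuous function F : ℝ → ℝ with these two properties. -/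
open Filter

/-- The quadratic map `y ↦ y ^ 2 - 3`. -/
def quadMap : ℝ → ℝ := fun y : ℝ => y^2 - 3

/-- The points whose whole orbit under `quadMap` stays in `[-p, p]`. -/
def survivingSet (p : ℝ) : Set ℝ := {x | ∀ n : ℕ, quadMap^[n] x ∈ Set.Icc (-p) p}

lemma quadMap_apply (y : ℝ) : quadMap y = y^2 - 3 := rfl

lemma continuous_quadMap : Continuous quadMap := by
  unfold quadMap
  fun_prop

lemma mem_Icc_of_mem_survivingSet {p x : ℝ} (hx : x ∈ survivingSet p) :
    x ∈ Set.Icc (-p) p := hx 0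

lemma iterate_mem_survivingSet {p x : ℝ} (hx : x ∈ survivingSet p) (n : ℕ) :
    quadMap^[n] x ∈ survivingSet p := fun m => by
  rw [← Function.iterate_add_apply]
  exact hx (m + n)

lemma quadMap_mem_survivingSet {p x : ℝ} (hx : x ∈ survivingSet p) :
    quadMap x ∈ survivingSet p := iterate_mem_survivingSet hx 1

lemma mem_survivingSet_of_quadMap_mem {p x : ℝ} (hx : x ∈ Set.Icc (-p) p)
    (h : quadMap x ∈ survivingSet p) : x ∈ survivingSet p := by
  rintro (_ | n)
  · exact hx
  · exact h n

lemma isClosed_survivingSet (p : ℝ) : IsClosed (survivingSet p) := by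
  simp only [survivingSet, Set.ofPred_forall]
  exact isClosed_iInter fun n => isClosed_Icc.preimage (continuous_quadMap.iterate n)

lemma isCompact_survivingSet (p : ℝ) : IsCompact (survivingSet p) :=
  isCompact_Icc.of_isClosed_subset (isClosed_survivingSet p)
    fun _ hx => mem_Icc_of_mem_survivingSet hx

lemma right_mem_survivingSet {p : ℝ} (hp : p^2 = p + 3) (h0 : 0 ≤ p) :
    p ∈ survivingSet p := fun n => by
  have hfix : quadMap p = p := by rw [quadMap_apply]; linarith
  rw [Function.iterate_fixed hfix]
  exact ⟨by linarith, le_rfl⟩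

lemma left_mem_survivingSet {p : ℝ} (hp : p^2 = p + 3) (h0 : 0 ≤ p) :
    -p ∈ survivingSet p := by
  refine mem_survivingSet_of_quadMap_mem ⟨le_rfl, by linarith⟩ ?_
  have : quadMap (-p) = p := by rw [quadMap_apply]; linarith
  rw [this]
  exact right_mem_survivingSet hp h0

lemma three_sub_le_sq_of_mem_survivingSet {p x : ℝ} (hx : x ∈ survivingSet p) :
    3 - p ≤ x^2 := by
  have := (hx 1).1
  rw [Function.iterate_one, quadMap_apply] at this
  linarith

/-- `quadMap` expands distances between surviving points of the same sign. -/
lemma expansion_of_mem_survivingSet {p x y : ℝ} (hp : p < 2.31)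
    (hx : x ∈ survivingSet p) (hy : y ∈ survivingSet p) (hxy : 0 ≤ x * y) :
    |x - y| * 1.6 ≤ |quadMap x - quadMap y| := by
  have hx2 := three_sub_le_sq_of_mem_survivingSet hx
  have hy2 := three_sub_le_sq_of_mem_survivingSet hy
  have hprod : (3 - p)^2 ≤ (x * y)^2 := by
    rw [mul_pow, sq (3 - p)]
    exact mul_le_mul hx2 hy2 (by linarith) (sq_nonneg x)
  have hmul : 3 - p ≤ x * y := le_of_sq_le_sq hprod hxy
  have hsum : 1.6 ≤ |x + y| := by
    refine le_abs.2 ?_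
    by_contra! h
    nlinarith
  have : quadMap x - quadMap y = (x - y) * (x + y) := by
    simp only [quadMap_apply]
    ring
  rw [this, abs_mul]
  exact mul_le_mul_of_nonneg_left hsum (abs_nonneg _)

lemma mul_nonneg_of_mem_isPreconnected {p x y : ℝ} (hp : p < 2.31) {S : Set ℝ}
    (hS : S ⊆ survivingSet p) (hc : IsPreconnected S) (hx : x ∈ S) (hy : y ∈ S) :
    0 ≤ x * y := by
  have h0 : (0 : ℝ) ∉ S := fun h => by
    have := three_sub_le_sq_of_mem_survivingSet (hS h)
    linarith
  by_contra! hneg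
  rcases mul_neg_iff.1 hneg with ⟨h1, h2⟩ | ⟨h1, h2⟩
  · exact h0 (hc.Icc_subset hy hx ⟨h2.le, h1.le⟩)
  · exact h0 (hc.Icc_subset hx hy ⟨h1.le, h2.le⟩)

lemma iterate_expansion_of_isPreconnected {p : ℝ} (hp : p < 2.31) (n : ℕ) {S : Set ℝ}
    (hS : S ⊆ survivingSet p) (hc : IsPreconnected S) {x y : ℝ} (hx : x ∈ S) (hy : y ∈ S) :
    |x - y| * 1.6^n ≤ |quadMap^[n] x - quadMap^[n] y| := by
  induction n generalizing S x y with
  | zero => simp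
  | succ n ih =>
    have hstep := expansion_of_mem_survivingSet hp (hS hx) (hS hy)
      (mul_nonneg_of_mem_isPreconnected hp hS hc hx hy)
    have hrest := ih (S := quadMap '' S)
      (Set.image_subset_iff.2 fun z hz => quadMap_mem_survivingSet (hS hz))
      (hc.image _ continuous_quadMap.continuousOn)
      (Set.mem_image_of_mem _ hx) (Set.mem_image_of_mem _ hy)
    rw [Function.iterate_succ_apply, Function.iterate_succ_apply]
    calc |x - y| * 1.6^(n + 1) = |x - y| * 1.6 * 1.6^n := by ring
      _ ≤ |quadMap x - quadMap y| * 1.6^n := by gcongr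
      _ ≤ _ := hrest

lemma abs_sub_le_of_mem_survivingSet {p x y : ℝ} (hx : x ∈ survivingSet p)
    (hy : y ∈ survivingSet p) : |x - y| ≤ 2 * p := by
  obtain ⟨hx1, hx2⟩ := mem_Icc_of_mem_survivingSet hx
  obtain ⟨hy1, hy2⟩ := mem_Icc_of_mem_survivingSet hy
  exact abs_le.2 ⟨by linarith, by linarith⟩

lemma isTotallyDisconnected_survivingSet {p : ℝ} (hp : p < 2.31) :
    IsTotallyDisconnected (survivingSet p) := by
  intro S hS hc x hx y hy
  by_contra hne
  have hpos : 0 < |x - y| := abs_pos.2 (sub_ne_zero.2 hne)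
  obtain ⟨n, hn⟩ := pow_unbounded_of_one_lt (2 * p / |x - y|) (by norm_num : (1 : ℝ) < 1.6)
  rw [div_lt_iff₀' hpos] at hn
  have h1 := iterate_expansion_of_isPreconnected hp n hS hc hx hy
  have h2 := abs_sub_le_of_mem_survivingSet (iterate_mem_survivingSet (hS hx) n)
    (iterate_mem_survivingSet (hS hy) n)
  linarith

/-- Every surviving point has a surviving preimage of prescribed sign. -/
lemma exists_preimage_mem_survivingSet {p w : ℝ} (hp : p^2 = p + 3) (h0 : 0 ≤ p)
    (hw : w ∈ survivingSet p) (x : ℝ) :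
    ∃ y ∈ survivingSet p, quadMap y = w ∧ 0 ≤ x * y := by
  obtain ⟨hw1, hw2⟩ := mem_Icc_of_mem_survivingSet hw
  have hnn : 0 ≤ w + 3 := by nlinarith
  have hsq := Real.sq_sqrt hnn
  have hs0 := Real.sqrt_nonneg (w + 3)
  have hsp : √(w + 3) ≤ p := Real.sqrt_le_iff.2 ⟨h0, by linarith⟩
  rcases le_total 0 x with hx | hx
  · have hq : quadMap (√(w + 3)) = w := by rw [quadMap_apply]; linarith
    exact ⟨√(w + 3), mem_survivingSet_of_quadMap_mem ⟨by linarith, hsp⟩ (by rwa [hq]), hq,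
      mul_nonneg hx hs0⟩
  · have hq : quadMap (-√(w + 3)) = w := by rw [quadMap_apply, neg_sq]; linarith
    exact ⟨-√(w + 3), mem_survivingSet_of_quadMap_mem ⟨by linarith, by linarith⟩ (by rwa [hq]), hq,
      mul_nonneg_of_nonpos_of_nonpos hx (by linarith)⟩

lemma exists_iterate_preimage_near {p w : ℝ} (hp : p^2 = p + 3) (h0 : 0 ≤ p) (hlt : p < 2.31)
    (hw : w ∈ survivingSet p) (n : ℕ) {x : ℝ} (hx : x ∈ survivingSet p) :
    ∃ y ∈ survivingSet p, quadMap^[n] y = w ∧ |x - y| * 1.6^n ≤ |quadMap^[n] x - w| := by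
  induction n generalizing x with
  | zero => exact ⟨w, hw, rfl, by simp⟩
  | succ n ih =>
    obtain ⟨z, hz, hzw, hzx⟩ := ih (quadMap_mem_survivingSet hx)
    obtain ⟨y, hy, rfl, hxy⟩ := exists_preimage_mem_survivingSet hp h0 hz x
    refine ⟨y, hy, hzw, ?_⟩
    rw [Function.iterate_succ_apply]
    calc |x - y| * 1.6^(n + 1) = |x - y| * 1.6 * 1.6^n := by ring
      _ ≤ |quadMap x - quadMap y| * 1.6^n := by
        gcongr
        exact expansion_of_mem_survivingSet hlt hx hy hxy
      _ ≤ _ := hzx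

lemma perfect_survivingSet {p : ℝ} (hp : p^2 = p + 3) (h0 : 0 < p) (hlt : p < 2.31) :
    Perfect (survivingSet p) := by
  refine ⟨isClosed_survivingSet p, fun x hx => ?_⟩
  rw [accPt_iff_nhds]
  intro U hU
  obtain ⟨ε, hε, hball⟩ := Metric.mem_nhds_iff.1 hU
  obtain ⟨n, hn⟩ := pow_unbounded_of_one_lt (2 * p / ε) (by norm_num : (1 : ℝ) < 1.6)
  rw [div_lt_iff₀' hε] at hn
  obtain ⟨w, hw, hne⟩ : ∃ w ∈ survivingSet p, quadMap^[n] x ≠ w := by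
    by_cases h : quadMap^[n] x = p
    · exact ⟨-p, left_mem_survivingSet hp h0.le, by rw [h]; linarith⟩
    · exact ⟨p, right_mem_survivingSet hp h0.le, h⟩
  obtain ⟨y, hy, hyw, hxy⟩ := exists_iterate_preimage_near hp h0.le hlt hw n hx
  refine ⟨y, ⟨hball ?_, hy⟩, fun h => hne (h ▸ hyw)⟩
  have h2 := abs_sub_le_of_mem_survivingSet (iterate_mem_survivingSet hx n) hw
  rw [Metric.mem_ball, Real.dist_eq, abs_sub_comm]
  exact lt_of_mul_lt_mul_right ((hxy.trans h2).trans_lt hn) (by positivity)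

lemma le_iterate_of_fixed_lt {p y : ℝ} (hp : p^2 = p + 3) (h1 : 1 ≤ p) (hy : p < y) (n : ℕ) :
    p + 2^n * (y - p) ≤ quadMap^[n] y := by
  induction n generalizing y with
  | zero => simp
  | succ n ih =>
    have hstep : 2 * (y - p) ≤ quadMap y - p := by
      rw [quadMap_apply]
      nlinarith
    rw [Function.iterate_succ_apply]
    calc p + 2^(n + 1) * (y - p) = p + 2^n * (2 * (y - p)) := by ring
      _ ≤ p + 2^n * (quadMap y - p) := by gcongr
      _ ≤ _ := ih (by linarith)

lemma tendsto_iterate_of_fixed_lt {p y : ℝ} (hp : p^2 = p + 3) (h1 : 1 ≤ p) (hy : p < y) :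
    Tendsto (fun n : ℕ => quadMap^[n] y) atTop atTop := by
  refine tendsto_atTop_mono (le_iterate_of_fixed_lt hp h1 hy) ?_
  exact tendsto_atTop_add_const_left _ _
    ((tendsto_pow_atTop_atTop_of_one_lt one_lt_two).atTop_mul_const (sub_pos.2 hy))

lemma tendsto_iterate_of_notMem_survivingSet {p x : ℝ} (hp : p^2 = p + 3) (h1 : 1 ≤ p)
    (hx : x ∉ survivingSet p) : Tendsto (fun n : ℕ => quadMap^[n] x) atTop atTop := by
  obtain ⟨m, hm⟩ : ∃ m : ℕ, quadMap^[m] x ∉ Set.Icc (-p) p := by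
    simpa only [survivingSet, Set.mem_ofPred_eq, not_forall] using hx
  have habs : p < |quadMap^[m] x| := by
    rw [Set.mem_Icc, ← abs_le, not_le] at hm
    exact hm
  have hgt : p < quadMap^[m + 1] x := by
    rw [Function.iterate_succ_apply', quadMap_apply, ← sq_abs]
    nlinarith
  rw [← tendsto_add_atTop_iff_nat (m + 1)]
  simpa only [Function.iterate_add_apply] using tendsto_iterate_of_fixed_lt hp h1 hgt

/-- Let `F x = x^2 - 3`, `p = (1 + √13)/2`, `I = [-p, p]`, and
`Λ = {x ∈ I : F^[n] x ∈ I for all n}`.  Then `Λ` is a Cantor set, `F^[n] x ∈ Λ` for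
every `x ∈ Λ` and `n ≥ 1`, and `F^[n] x → +∞` for every `x ∉ Λ`.  In particular
there exist a Cantor set `Λ' ⊆ ℝ` and a continuous `F' : ℝ → ℝ` with these
two properties. -/
theorem stmt13 (p : ℝ) (hp : p = (1 + Real.sqrt 13) / 2)
    (Λ : Set ℝ)
    (hΛ : Λ = {x ∈ Set.Icc (-p) p |
      ∀ n : ℕ, (fun y : ℝ => y^2 - 3)^[n] x ∈ Set.Icc (-p) p}) :
    (Λ.Nonempty ∧ IsCompact Λ ∧ Perfect Λ ∧ IsTotallyDisconnected Λ) ∧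
    (∀ x ∈ Λ, ∀ n : ℕ, 1 ≤ n → (fun y : ℝ => y^2 - 3)^[n] x ∈ Λ) ∧
    (∀ x : ℝ, x ∉ Λ →
      Tendsto (fun n : ℕ => (fun y : ℝ => y^2 - 3)^[n] x) atTop atTop) ∧
    (∃ (Λ' : Set ℝ) (F : ℝ → ℝ),
      (Λ'.Nonempty ∧ IsCompact Λ' ∧ Perfect Λ' ∧ IsTotallyDisconnected Λ') ∧
      Continuous F ∧
      (∀ x ∈ Λ', ∀ n : ℕ, 1 ≤ n → F^[n] x ∈ Λ') ∧
      (∀ x : ℝ, x ∉ Λ' → Tendsto (fun n : ℕ => F^[n] x) atTop atTop)) := by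
  have hs := Real.sq_sqrt (by norm_num : (0 : ℝ) ≤ 13)
  have hs0 := Real.sqrt_nonneg 13
  have hsq : p^2 = p + 3 := by rw [hp]; linarith
  have hlt : p < 2.31 := by rw [hp]; nlinarith
  have hone : 1 ≤ p := by rw [hp]; nlinarith
  have hEq : Λ = survivingSet p := by
    rw [hΛ]
    exact Set.ext fun x => ⟨fun h => h.2, fun h => ⟨h 0, h⟩⟩
  have hcantor : Λ.Nonempty ∧ IsCompact Λ ∧ Perfect Λ ∧ IsTotallyDisconnected Λ := by
    rw [hEq]
    exact ⟨⟨p, right_mem_survivingSet hsq (by linarith)⟩, isCompact_survivingSet p,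
      perfect_survivingSet hsq (by linarith) hlt, isTotallyDisconnected_survivingSet hlt⟩
  have hinv : ∀ x ∈ Λ, ∀ n : ℕ, 1 ≤ n → quadMap^[n] x ∈ Λ := by
    rw [hEq]
    exact fun x hx n _ => iterate_mem_survivingSet hx n
  have hdiv : ∀ x : ℝ, x ∉ Λ → Tendsto (fun n : ℕ => quadMap^[n] x) atTop atTop := by
    rw [hEq]
    exact fun x hx => tendsto_iterate_of_notMem_survivingSet hsq hone hx
  exact ⟨hcantor, hinv, hdiv, Λ, quadMap, hcantor, continuous_quadMap, hinv, hdiv⟩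
end

section
/- Let a < b be real numbers and let Λ* ⊆ [a, b] be a Cantor set with a ∈ Λ* and b ∈ Λ*. Then for every closed subinterval [c, d] ⊆ [a, b] with c < d, there exist points e, f ∈ Λ* with e < f such that the open interval (e, f) is disjoint from Λ*, e − c < (2/3)(d − c), and d − f < (2/3)(d − c). -/
/-- A totally disconnected set of reals misses a point of every nondegenerate open interval. -/
theorem IsTotallyDisconnected.exists_mem_Ioo_notMem {s : Set ℝ} (hs : IsTotallyDisconnected s)
    {p q : ℝ} (hpq : p < q) : ∃ m ∈ Set.Ioo p q, m ∉ s := by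
  by_contra! h
  obtain ⟨x, hpx, hxq⟩ := exists_between hpq
  obtain ⟨y, hxy, hyq⟩ := exists_between hxq
  exact hxy.ne (hs (Set.Ioo p q) h isPreconnected_Ioo ⟨hpx, hxq⟩ ⟨hpx.trans hxy, hyq⟩)

/-- A point outside a compact set, lying between two of its points, lies in a gap of the set. -/
theorem IsCompact.exists_gap {s : Set ℝ} (hs : IsCompact s) {a b m : ℝ} (ha : a ∈ s)
    (hb : b ∈ s) (ham : a ≤ m) (hmb : m ≤ b) (hm : m ∉ s) :
    ∃ e ∈ s, ∃ f ∈ s, e < m ∧ m < f ∧ Set.Ioo e f ∩ s = ∅ := by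
  obtain ⟨e, ⟨hes, hem⟩, he⟩ := (hs.inter_right isClosed_Iic).exists_isGreatest ⟨a, ha, ham⟩
  obtain ⟨f, ⟨hfs, hmf⟩, hf⟩ := (hs.inter_right isClosed_Ici).exists_isLeast ⟨b, hb, hmb⟩
  refine ⟨e, hes, f, hfs, lt_of_le_of_ne hem (ne_of_mem_of_not_mem hes hm),
    lt_of_le_of_ne hmf (ne_of_mem_of_not_mem hfs hm).symm, ?_⟩
  rw [Set.eq_empty_iff_forall_notMem]
  rintro x ⟨⟨hex, hxf⟩, hxs⟩
  rcases le_total x m with h | h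
  · exact hex.not_ge (he ⟨hxs, h⟩)
  · exact hxf.not_ge (hf ⟨hxs, h⟩)


/-- Let `a < b` and let `Λ* ⊆ [a, b]` be a Cantor set with `a, b ∈ Λ*`.  Then for every
closed subinterval `[c, d] ⊆ [a, b]` with `c < d`, there exist `e, f ∈ Λ*` with `e < f`
such that `(e, f)` is disjoint from `Λ*`, `e - c < (2/3)(d - c)`, and
`d - f < (2/3)(d - c)`. -/
theorem stmt14 (a b : ℝ) (hab : a < b) (Λ : Set ℝ) (hsub : Λ ⊆ Set.Icc a b)
    (hne : Λ.Nonempty) (hcomp : IsCompact Λ) (hperf : Perfect Λ)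
    (htd : IsTotallyDisconnected Λ) (haΛ : a ∈ Λ) (hbΛ : b ∈ Λ)
    (c d : ℝ) (hac : a ≤ c) (hcd : c < d) (hdb : d ≤ b) :
    ∃ e f : ℝ, e ∈ Λ ∧ f ∈ Λ ∧ e < f ∧ Set.Ioo e f ∩ Λ = ∅ ∧
      e - c < (2/3) * (d - c) ∧ d - f < (2/3) * (d - c) := by
  obtain ⟨m, ⟨hpm, hmq⟩, hm⟩ := htd.exists_mem_Ioo_notMem
    (show c + (d - c) / 3 < c + 2 * (d - c) / 3 by linarith)
  obtain ⟨e, he, f, hf, hem, hmf, hgap⟩ :=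
    hcomp.exists_gap haΛ hbΛ (show a ≤ m by linarith) (by linarith) hm
  exact ⟨e, f, he, hf, hem.trans hmf, hgap, by linarith, by linarith⟩
end

section
/- Let a < b be real numbers and let Λ* ⊆ [a, b] be a Cantor set with a ∈ Λ* and b ∈ Λ*. Then there exists a sequence (Cₙ*)_{n≥0} of closed subsets of [a, b] such that: C₀* = [a, b]; Cₙ₊₁* ⊆ Cₙ* for all n; each Cₙ* is a disjoint union of exactly 2ⁿ nondegenerate closed intervals, each of length at most (2/3)ⁿ(b − a); the boundary of Cₙ* (the endpoints of these intervals) is contained in Λ*; and ⋂ₙ Cₙ* = Λ*. -/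
/-- A nondegenerate interval, encoded by its pair of endpoints, whose endpoints belong to `S` and
are accumulated by `S` from the inside. -/
structure IsSpanned (S : Set ℝ) (I : ℝ × ℝ) : Prop where
  lt : I.1 < I.2
  left_mem : I.1 ∈ S
  right_mem : I.2 ∈ S
  exists_right_of_left : ∀ y, I.1 < y → ∃ z ∈ S, I.1 < z ∧ z < y
  exists_left_of_right : ∀ y, y < I.2 → ∃ z ∈ S, y < z ∧ z < I.2

/-- A point of a perfect set with no points of the set just to its left is accumulated from the
right. -/
theorem Perfect.exists_mem_Ioo_right {S : Set ℝ} (hS : Perfect S) {x c y : ℝ} (hx : x ∈ S)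
    (hcx : c < x) (hgap : ∀ z ∈ S, c < z → x ≤ z) (hxy : x < y) :
    ∃ z ∈ S, x < z ∧ z < y := by
  obtain ⟨z, ⟨hz, hzS⟩, hzx⟩ := (accPt_iff_nhds.1 (hS.acc x hx)) _ (Ioo_mem_nhds hcx hxy)
  exact ⟨z, hzS, lt_of_le_of_ne (hgap z hzS hz.1) hzx.symm, hz.2⟩

/-- A point of a perfect set with no points of the set just to its right is accumulated from the
left. -/
theorem Perfect.exists_mem_Ioo_left {S : Set ℝ} (hS : Perfect S) {x c y : ℝ} (hx : x ∈ S)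
    (hxc : x < c) (hgap : ∀ z ∈ S, z < c → z ≤ x) (hyx : y < x) :
    ∃ z ∈ S, y < z ∧ z < x := by
  obtain ⟨z, ⟨hz, hzS⟩, hzx⟩ := (accPt_iff_nhds.1 (hS.acc x hx)) _ (Ioo_mem_nhds hyx hxc)
  exact ⟨z, hzS, hz.1, lt_of_le_of_ne (hgap z hzS hz.2) hzx⟩

theorem IsTotallyDisconnected.exists_mem_Ioo_notMem_s15 {S : Set ℝ} (hS : IsTotallyDisconnected S)
    {u v : ℝ} (huv : u < v) : ∃ x ∈ Set.Ioo u v, x ∉ S := by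
  by_contra! h
  obtain ⟨x, hx⟩ := exists_between huv
  obtain ⟨y, hy⟩ := exists_between hx.2
  exact hy.1.ne (hS _ h isPreconnected_Ioo hx ⟨hx.1.trans hy.1, hy.2⟩)

theorem IsClosed.exists_gap {S : Set ℝ} (hS : IsClosed S) {e f x : ℝ} (he : e ∈ S) (hf : f ∈ S)
    (hx : x ∉ S) (hex : e < x) (hxf : x < f) :
    ∃ p ∈ S, ∃ q ∈ S, p < x ∧ x < q ∧ ∀ z ∈ S, z ≤ p ∨ q ≤ z := by
  have hbdd : BddAbove (S ∩ Set.Iic x) := ⟨x, fun z hz => hz.2⟩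
  have hbdd' : BddBelow (S ∩ Set.Ici x) := ⟨x, fun z hz => hz.2⟩
  have hp := (hS.inter isClosed_Iic).csSup_mem ⟨e, he, hex.le⟩ hbdd
  have hq := (hS.inter isClosed_Ici).csInf_mem ⟨f, hf, hxf.le⟩ hbdd'
  refine ⟨_, hp.1, _, hq.1, lt_of_le_of_ne hp.2 fun h => hx (h ▸ hp.1),
    lt_of_le_of_ne hq.2 fun h => hx (h ▸ hq.1), fun z hz => ?_⟩
  rcases le_total z x with h | h
  · exact Or.inl (le_csSup hbdd ⟨hz, h⟩)
  · exact Or.inr (csInf_le hbdd' ⟨hz, h⟩)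

/-- An interval spanned by a perfect totally disconnected set splits into two spanned intervals,
each at most two thirds as long, on removing a gap of the set. -/
theorem IsSpanned.exists_split {S : Set ℝ} (hS : Perfect S) (htd : IsTotallyDisconnected S)
    {I : ℝ × ℝ} (hI : IsSpanned S I) :
    ∃ J K : {I : ℝ × ℝ // IsSpanned S I},
      J.1.1 = I.1 ∧ J.1.2 < K.1.1 ∧ K.1.2 = I.2 ∧
      J.1.2 - J.1.1 ≤ 2 / 3 * (I.2 - I.1) ∧ K.1.2 - K.1.1 ≤ 2 / 3 * (I.2 - I.1) ∧
      ∀ z ∈ S, z ≤ J.1.2 ∨ K.1.1 ≤ z := by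
  obtain ⟨e, f⟩ := I
  obtain ⟨hlt, he, hf, her, hfl⟩ := hI
  dsimp only at *
  obtain ⟨x, ⟨hx1, hx2⟩, hxS⟩ := htd.exists_mem_Ioo_notMem_s15
    (show e + (f - e) / 3 < e + 2 * (f - e) / 3 by linarith)
  have hex : e < x := by linarith
  have hxf : x < f := by linarith
  obtain ⟨p, hp, q, hq, hpx, hxq, hgap⟩ := hS.closed.exists_gap he hf hxS hex hxf
  have hep : e < p := by
    obtain ⟨z, hz, h1, h2⟩ := her x hex
    rcases hgap z hz with h | h <;> linarith
  have hqf : q < f := by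
    obtain ⟨z, hz, h1, h2⟩ := hfl x hxf
    rcases hgap z hz with h | h <;> linarith
  refine ⟨⟨(e, p), hep, he, hp, her, fun y hy => ?_⟩, ⟨(q, f), hqf, hq, hf, fun y hy => ?_, hfl⟩,
    rfl, hpx.trans hxq, rfl, ?_, ?_, hgap⟩
  · exact hS.exists_mem_Ioo_left hp hpx
      (fun z hz h => (hgap z hz).resolve_right (by linarith)) hy
  · exact hS.exists_mem_Ioo_right hq hxq
      (fun z hz h => (hgap z hz).resolve_left (by linarith)) hy
  · dsimp only; linarith
  · dsimp only; linarith

/-- The `k`-th vertex at level `n` of the binary tree grown from `x` with children maps `l`, `r`. -/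
def binaryTree {α : Type*} (l r : α → α) (x : α) : ℕ → ℕ → α
  | 0, _ => x
  | n + 1, k => if k % 2 = 0 then l (binaryTree l r x n (k / 2)) else r (binaryTree l r x n (k / 2))


/-- Let `a < b` and let `Λ* ⊆ [a, b]` be a Cantor set with `a, b ∈ Λ*`.  Then there is a
nested sequence `(Cₙ*)` of closed subsets of `[a, b]` with `C₀* = [a, b]`, each `Cₙ*` a
disjoint union of exactly `2^n` nondegenerate closed intervals of length at most
`(2/3)^n (b - a)` whose endpoints lie in `Λ*`, and `⋂ₙ Cₙ* = Λ*`. -/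
theorem stmt15 (a b : ℝ) (hab : a < b) (Λ : Set ℝ) (hsub : Λ ⊆ Set.Icc a b)
    (hne : Λ.Nonempty) (hcomp : IsCompact Λ) (hperf : Perfect Λ)
    (htd : IsTotallyDisconnected Λ) (haΛ : a ∈ Λ) (hbΛ : b ∈ Λ) :
    ∃ C : ℕ → Set ℝ,
      C 0 = Set.Icc a b ∧
      (∀ n : ℕ, C (n+1) ⊆ C n) ∧
      (∀ n : ℕ, ∃ e f : Fin (2^n) → ℝ,
        (∀ i, e i < f i) ∧
        (∀ i j, i < j → f i < e j) ∧
        (C n = ⋃ i, Set.Icc (e i) (f i)) ∧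
        (∀ i, f i - e i ≤ (2/3)^n * (b - a)) ∧
        (∀ i, e i ∈ Λ ∧ f i ∈ Λ)) ∧
      (⋂ n, C n) = Λ := by
  have hab' : IsSpanned Λ (a, b) := ⟨hab, haΛ, hbΛ,
    fun y hy => hperf.exists_mem_Ioo_right haΛ (sub_one_lt a) (fun z hz _ => (hsub hz).1) hy,
    fun y hy => hperf.exists_mem_Ioo_left hbΛ (lt_add_one b) (fun z hz _ => (hsub hz).2) hy⟩
  choose l r hl hlr hr hllen hrlen hgap using
    fun I : {I : ℝ × ℝ // IsSpanned Λ I} => I.2.exists_split hperf htd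
  set T := binaryTree l r ⟨(a, b), hab'⟩ with hT
  have hT0 : ∀ k, (T 0 k).1 = (a, b) := fun _ => rfl
  have hTl : ∀ n k, k % 2 = 0 → T (n + 1) k = l (T n (k / 2)) := fun n k h => by
    simp [hT, binaryTree, h]
  have hTr : ∀ n k, k % 2 = 1 → T (n + 1) k = r (T n (k / 2)) := fun n k h => by
    simp [hT, binaryTree, h]
  have hleft : ∀ n k, (T n (k / 2)).1.1 ≤ (T (n + 1) k).1.1 := fun n k => by
    rcases Nat.mod_two_eq_zero_or_one k with h | h
    · rw [hTl n k h, hl]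
    · rw [hTr n k h]
      have h1 := (l (T n (k / 2))).2.lt
      have h2 := hlr (T n (k / 2))
      rw [hl] at h1
      linarith
  have hright : ∀ n k, (T (n + 1) k).1.2 ≤ (T n (k / 2)).1.2 := fun n k => by
    rcases Nat.mod_two_eq_zero_or_one k with h | h
    · rw [hTl n k h]
      have h1 := (r (T n (k / 2))).2.lt
      have h2 := hlr (T n (k / 2))
      rw [hr] at h1
      linarith
    · rw [hTr n k h, hr]
  have hlen : ∀ n k, (T n k).1.2 - (T n k).1.1 ≤ (2 / 3) ^ n * (b - a) := by
    intro n
    induction n with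
    | zero => intro k; simp [hT0]
    | succ n ih =>
      intro k
      have h1 := ih (k / 2)
      rw [pow_succ]
      rcases Nat.mod_two_eq_zero_or_one k with h | h
      · rw [hTl n k h]
        linarith [hllen (T n (k / 2))]
      · rw [hTr n k h]
        linarith [hrlen (T n (k / 2))]
  have hord : ∀ n i j, i < j → j < 2 ^ n → (T n i).1.2 < (T n j).1.1 := by
    intro n
    induction n with
    | zero => intro i j hij hj; omega
    | succ n ih =>
      intro i j hij hj
      rcases (Nat.div_le_div_right hij.le : i / 2 ≤ j / 2).lt_or_eq with h | h
      · exact (hright n i).trans_lt ((ih _ _ h (by omega)).trans_le (hleft n j))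
      · rw [hTl n i (by omega), hTr n j (by omega), h]
        exact hlr _
  have hcover : ∀ n, ∀ z ∈ Λ, ∃ k < 2 ^ n, z ∈ Set.Icc (T n k).1.1 (T n k).1.2 := by
    intro n z hz
    induction n with
    | zero => exact ⟨0, by simp, hsub hz⟩
    | succ n ih =>
      obtain ⟨k, hk, hz1, hz2⟩ := ih
      rcases hgap (T n k) z hz with h | h
      · refine ⟨2 * k, by omega, ?_⟩
        rw [hTl n _ (by omega), show 2 * k / 2 = k by omega]
        exact ⟨(hl _).trans_le hz1, h⟩
      · refine ⟨2 * k + 1, by omega, ?_⟩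
        rw [hTr n _ (by omega), show (2 * k + 1) / 2 = k by omega]
        exact ⟨h, hz2.trans_eq (hr _).symm⟩
  refine ⟨fun n => ⋃ i : Fin (2 ^ n), Set.Icc (T n i).1.1 (T n i).1.2, ?_, fun n => ?_,
    fun n => ⟨fun i => (T n i).1.1, fun i => (T n i).1.2, fun i => (T n i).2.lt,
      fun i j hij => hord n i j hij j.2, rfl, fun i => hlen n i,
      fun i => ⟨(T n i).2.left_mem, (T n i).2.right_mem⟩⟩, ?_⟩
  · simp only [hT0]
    have : Nonempty (Fin (2 ^ 0)) := ⟨⟨0, by simp⟩⟩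
    exact Set.iUnion_const _
  · refine Set.iUnion_subset fun i => ?_
    exact (Set.Icc_subset_Icc (hleft n i) (hright n i)).trans
      (Set.subset_iUnion (fun j : Fin (2 ^ n) => Set.Icc (T n j).1.1 (T n j).1.2)
        ⟨i / 2, by have := i.2; omega⟩)
  · refine Set.Subset.antisymm (fun x hx => ?_) fun z hz => Set.mem_iInter.2 fun n => ?_
    · rw [← hcomp.isClosed.closure_eq, Metric.mem_closure_iff]
      intro ε hε
      obtain ⟨n, hn⟩ := exists_pow_lt_of_lt_one (div_pos hε (sub_pos.2 hab))
        (show (2 / 3 : ℝ) < 1 by norm_num)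
      rw [lt_div_iff₀ (sub_pos.2 hab)] at hn
      obtain ⟨i, hi1, hi2⟩ := Set.mem_iUnion.1 (Set.mem_iInter.1 hx n)
      refine ⟨_, (T n i).2.left_mem, ?_⟩
      rw [Real.dist_eq, abs_of_nonneg (by linarith)]
      linarith [hlen n i]
    · obtain ⟨k, hk, h⟩ := hcover n z hz
      exact Set.mem_iUnion.2 ⟨⟨k, hk⟩, h⟩
end

section
/- Let Λ ⊆ ℝ and Λ* ⊆ ℝ be Cantor sets. Then there exists a strictly increasing homeomorphism φ : ℝ → ℝ such that φ(Λ) = Λ* (and consequently φ(ℝ \ Λ) = ℝ \ Λ*). -/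
open Set Topology

/-- A relation between subsets of the line that preserves and reflects the strict order, with dense
domain and dense range, extends to an order isomorphism of the line. -/
theorem exists_orderIso_extending (R : ℝ → ℝ → Prop)
    (hlt : ∀ {x y x' y'}, R x y → R x' y' → (x < x' ↔ y < y'))
    (hdom : ∀ {a b : ℝ}, a < b → ∃ x y, a < x ∧ x < b ∧ R x y)
    (hran : ∀ {a b : ℝ}, a < b → ∃ x y, a < y ∧ y < b ∧ R x y) :
    ∃ φ : ℝ ≃o ℝ, ∀ x y, R x y → φ x = y := by
  let S : ℝ → Set ℝ := fun x => {y | ∃ x' < x, R x' y}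
  have hne (x : ℝ) : (S x).Nonempty := by
    obtain ⟨d, e, -, h, hR⟩ := hdom (sub_one_lt x)
    exact ⟨e, d, h, hR⟩
  have hub {x d e : ℝ} (hR : R d e) (hx : x ≤ d) : e ∈ upperBounds (S x) := by
    rintro y ⟨x', hx', hR'⟩
    exact ((hlt hR' hR).1 (hx'.trans_le hx)).le
  have hbdd (x : ℝ) : BddAbove (S x) := by
    obtain ⟨d, e, h, -, hR⟩ := hdom (lt_add_one x)
    exact ⟨e, hub hR h.le⟩
  have hle {x d e : ℝ} (hR : R d e) (hx : x ≤ d) : sSup (S x) ≤ e := csSup_le (hne x) (hub hR hx)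
  have hge {x d e : ℝ} (hR : R d e) (hx : d < x) : e ≤ sSup (S x) :=
    le_csSup (hbdd x) ⟨d, hx, hR⟩
  have hmono : StrictMono fun x => sSup (S x) := by
    intro x z hxz
    obtain ⟨d₁, e₁, h₁, h₁', hR₁⟩ := hdom hxz
    obtain ⟨d₂, e₂, h₂, h₂', hR₂⟩ := hdom h₁'
    exact (hle hR₁ h₁.le).trans_lt (((hlt hR₁ hR₂).1 h₂).trans_le (hge hR₂ h₂'))
  have hsurj : Function.Surjective fun x => sSup (S x) := by
    intro y
    let T : Set ℝ := {x | ∃ y' < y, R x y'}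
    have hTub {d e : ℝ} (hR : R d e) (h : y ≤ e) : d ∈ upperBounds T := by
      rintro x ⟨y', hy', hR'⟩
      exact ((hlt hR' hR).2 (hy'.trans_le h)).le
    have hTne : T.Nonempty := by
      obtain ⟨d, e, -, h, hR⟩ := hran (sub_one_lt y)
      exact ⟨d, e, h, hR⟩
    have hTbdd : BddAbove T := by
      obtain ⟨d, e, h, -, hR⟩ := hran (lt_add_one y)
      exact ⟨d, hTub hR h.le⟩
    refine ⟨sSup T, le_antisymm ?_ ?_⟩
    · by_contra! h
      obtain ⟨d, e, h₁, h₂, hR⟩ := hran h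
      exact h₂.not_ge (hle hR (csSup_le hTne (hTub hR h₁.le)))
    · by_contra! h
      obtain ⟨d₁, e₁, h₁, h₁', hR₁⟩ := hran h
      obtain ⟨d₂, e₂, h₂, h₂', hR₂⟩ := hran h₁'
      exact h₁.not_ge
        (hge hR₁ (((hlt hR₁ hR₂).2 h₂).trans_le (le_csSup hTbdd ⟨e₂, h₂', hR₂⟩)))
  refine ⟨hmono.orderIsoOfSurjective _ hsurj, fun x y hR => le_antisymm (hle hR le_rfl) ?_⟩
  by_contra! h
  obtain ⟨d, e, h₁, h₂, hR'⟩ := hran h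
  exact h₁.not_ge (hge hR' ((hlt hR' hR).2 h₂))

theorem IsTotallyDisconnected.exists_notMem_Ioo {K : Set ℝ} (hK : IsTotallyDisconnected K)
    {a b : ℝ} (hab : a < b) : ∃ x ∈ Ioo a b, x ∉ K := by
  by_contra! h
  obtain ⟨c, hac, hcb⟩ := exists_between hab
  obtain ⟨d, hcd, hdb⟩ := exists_between hcb
  exact hcd.ne (hK (Icc c d) (fun x hx => h x ⟨hac.trans_le hx.1, hx.2.trans_lt hdb⟩)
    isPreconnected_Icc (left_mem_Icc.2 hcd.le) (right_mem_Icc.2 hcd.le))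

theorem Perfect.exists_mem_Ioo_ne {K : Set ℝ} (hK : Perfect K) {a b x : ℝ} (hx : x ∈ K)
    (hab : x ∈ Ioo a b) : ∃ y ∈ K, y ∈ Ioo a b ∧ y ≠ x := by
  obtain ⟨y, hy, hne⟩ := accPt_iff_nhds.1 (hK.acc x hx) _ (Ioo_mem_nhds hab.1 hab.2)
  exact ⟨y, hy.2, hy.1, hne⟩

/-- `IsGap K a b` says that `(a, b)` is a bounded connected component of the complement of `K`. -/
structure IsGap (K : Set ℝ) (a b : ℝ) : Prop where
  left_mem : a ∈ K
  right_mem : b ∈ K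
  lt : a < b
  notMem : ∀ x ∈ Ioo a b, x ∉ K

/-- The left endpoints of the bounded gaps of `K`, indexing these gaps. -/
abbrev Gap (K : Set ℝ) : Type := {a : ℝ // ∃ b, IsGap K a b}

namespace Gap

variable {K : Set ℝ}

/-- The right endpoint of a gap. -/
noncomputable def right (p : Gap K) : ℝ := p.2.choose

theorem isGap (p : Gap K) : IsGap K p.1 p.right := p.2.choose_spec

theorem right_le {p : Gap K} {x : ℝ} (hx : x ∈ K) (h : p.1 < x) : p.right ≤ x :=
  not_lt.1 fun h' => p.isGap.notMem x ⟨h, h'⟩ hx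

theorem le_left {p : Gap K} {x : ℝ} (hx : x ∈ K) (h : x < p.right) : x ≤ p.1 :=
  not_lt.1 fun h' => p.isGap.notMem x ⟨h', h⟩ hx

theorem right_le_left {p q : Gap K} (h : p < q) : p.right ≤ q.1 := right_le q.isGap.left_mem h

theorem exists_mem (hK : IsClosed K) {a b x : ℝ} (ha : a ∈ K) (hb : b ∈ K) (hx : x ∉ K)
    (hax : a < x) (hxb : x < b) : ∃ p : Gap K, p.1 < x ∧ x < p.right := by
  have hA : sSup (K ∩ Iic x) ∈ K ∩ Iic x :=
    (hK.inter isClosed_Iic).csSup_mem ⟨a, ha, hax.le⟩ ⟨x, fun y hy => hy.2⟩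
  have hB : sInf (K ∩ Ici x) ∈ K ∩ Ici x :=
    (hK.inter isClosed_Ici).csInf_mem ⟨b, hb, hxb.le⟩ ⟨x, fun y hy => hy.2⟩
  have hAx : sSup (K ∩ Iic x) < x := lt_of_le_of_ne hA.2 fun h => hx (h ▸ hA.1)
  have hxB : x < sInf (K ∩ Ici x) := lt_of_le_of_ne hB.2 fun h => hx (h ▸ hB.1)
  have hgap : IsGap K (sSup (K ∩ Iic x)) (sInf (K ∩ Ici x)) := by
    refine ⟨hA.1, hB.1, hAx.trans hxB, fun y hy hyK => ?_⟩
    rcases le_total y x with h | h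
    · exact hy.1.not_ge (le_csSup ⟨x, fun y hy => hy.2⟩ ⟨hyK, h⟩)
    · exact hy.2.not_ge (csInf_le ⟨x, fun y hy => hy.2⟩ ⟨hyK, h⟩)
  let p : Gap K := ⟨_, _, hgap⟩
  refine ⟨p, hAx, not_le.1 fun h => ?_⟩
  exact p.isGap.lt.not_ge (le_csSup ⟨x, fun y hy => hy.2⟩ ⟨p.isGap.right_mem, h⟩)

theorem exists_between_mem (hK : IsClosed K) (hd : IsTotallyDisconnected K) {a b : ℝ}
    (ha : a ∈ K) (hb : b ∈ K) (hab : a < b) : ∃ p : Gap K, a ≤ p.1 ∧ p.1 < b := by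
  obtain ⟨x, ⟨hax, hxb⟩, hx⟩ := hd.exists_notMem_Ioo hab
  obtain ⟨p, hpx, hxp⟩ := exists_mem hK ha hb hx hax hxb
  exact ⟨p, le_left ha (hax.trans hxp), hpx.trans hxb⟩

theorem right_ne_left (hK : Perfect K) (p q : Gap K) : p.right ≠ q.1 := by
  intro h
  obtain ⟨y, hyK, hy, hne⟩ := hK.exists_mem_Ioo_ne p.isGap.right_mem
    (show p.right ∈ Ioo p.1 q.right from ⟨p.isGap.lt, h ▸ q.isGap.lt⟩)
  exact hne ((h ▸ le_left hyK hy.2).antisymm (right_le hyK hy.1))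

theorem exists_left_lt (hK : Perfect K) (p : Gap K) : ∃ x ∈ K, x < p.1 := by
  obtain ⟨y, hyK, hy, hne⟩ := hK.exists_mem_Ioo_ne p.isGap.left_mem
    (show p.1 ∈ Ioo (p.1 - 1) p.right from ⟨sub_one_lt _, p.isGap.lt⟩)
  exact ⟨y, hyK, lt_of_le_of_ne (le_left hyK hy.2) hne⟩

theorem exists_right_gt (hK : Perfect K) (p : Gap K) : ∃ x ∈ K, p.right < x := by
  obtain ⟨y, hyK, hy, hne⟩ := hK.exists_mem_Ioo_ne p.isGap.right_mem
    (show p.right ∈ Ioo p.1 (p.right + 1) from ⟨p.isGap.lt, lt_add_one _⟩)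
  exact ⟨y, hyK, lt_of_le_of_ne (right_le hyK hy.1) hne.symm⟩

instance : Countable (Gap K) := by
  refine (countable_setOfPred_isolated_right_within (s := K)).mono ?_ |>.to_subtype
  rintro a ⟨b, h⟩
  refine ⟨h.left_mem, Filter.empty_mem_iff_bot.1 (mem_nhdsWithin.2 ⟨Iio b, isOpen_Iio, h.lt, ?_⟩)⟩
  rintro x ⟨hxb, hxK, hax⟩
  exact h.notMem x ⟨hax, hxb⟩ hxK

theorem denselyOrdered (hK : Perfect K) (hd : IsTotallyDisconnected K) :
    DenselyOrdered (Gap K) where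
  dense p q hpq := by
    obtain ⟨r, hr, hr'⟩ := exists_between_mem hK.closed hd p.isGap.right_mem q.isGap.left_mem
      (lt_of_le_of_ne (right_le_left hpq) (right_ne_left hK p q))
    exact ⟨r, p.isGap.lt.trans_le hr, hr'⟩

theorem noMinOrder (hK : Perfect K) (hd : IsTotallyDisconnected K) : NoMinOrder (Gap K) where
  exists_lt p := by
    obtain ⟨x, hx, hxp⟩ := p.exists_left_lt hK
    obtain ⟨q, -, hq⟩ := exists_between_mem hK.closed hd hx p.isGap.left_mem hxp
    exact ⟨q, hq⟩

theorem noMaxOrder (hK : Perfect K) (hd : IsTotallyDisconnected K) : NoMaxOrder (Gap K) where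
  exists_gt p := by
    obtain ⟨x, hx, hxp⟩ := p.exists_right_gt hK
    obtain ⟨q, hq, -⟩ := exists_between_mem hK.closed hd p.isGap.right_mem hx hxp
    exact ⟨q, p.isGap.lt.trans_le hq⟩

theorem nonempty (hK : Perfect K) (hd : IsTotallyDisconnected K) (hne : K.Nonempty) :
    Nonempty (Gap K) := by
  obtain ⟨x, hx⟩ := hne
  obtain ⟨y, hy, -, hxy⟩ := hK.exists_mem_Ioo_ne hx
    (show x ∈ Ioo (x - 1) (x + 1) from ⟨sub_one_lt x, lt_add_one x⟩)
  rcases hxy.lt_or_gt with h | h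
  · exact (exists_between_mem hK.closed hd hy hx h).nonempty
  · exact (exists_between_mem hK.closed hd hx hy h).nonempty

/-- The graph of the bijection between the complements of `K` and `K'` that maps each bounded gap
`p` affinely onto `g p` and is a translation on each unbounded gap. -/
def Rel {K' : Set ℝ} (g : Gap K ≃o Gap K') (x y : ℝ) : Prop :=
  (x < sInf K ∧ y < sInf K' ∧ x - sInf K = y - sInf K') ∨
  (sSup K < x ∧ sSup K' < y ∧ x - sSup K = y - sSup K') ∨
  ∃ p : Gap K, x ∈ Ioo p.1 p.right ∧ y ∈ Ioo (g p).1 (g p).right ∧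
    (x - p.1) * ((g p).right - (g p).1) = (y - (g p).1) * (p.right - p.1)

namespace Rel

variable {K' : Set ℝ} {g : Gap K ≃o Gap K'} {x y x' y' : ℝ}

theorem symm (h : Rel g x y) : Rel g.symm y x := by
  rcases h with ⟨h₁, h₂, h₃⟩ | ⟨h₁, h₂, h₃⟩ | ⟨p, h₁, h₂, h₃⟩
  · exact .inl ⟨h₂, h₁, h₃.symm⟩
  · exact .inr (.inl ⟨h₂, h₁, h₃.symm⟩)
  · exact .inr (.inr ⟨g p, h₂, by simpa using h₁, by simpa using h₃.symm⟩)

theorem notMem (hK : IsCompact K) (h : Rel g x y) : x ∉ K := by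
  intro hx
  rcases h with ⟨h, -⟩ | ⟨h, -⟩ | ⟨p, h, -⟩
  · exact h.not_ge (csInf_le hK.bddBelow hx)
  · exact h.not_ge (le_csSup hK.bddAbove hx)
  · exact p.isGap.notMem x h hx

theorem lt_of_lt (hK : IsCompact K) (hK' : IsCompact K') (h : Rel g x y) (h' : Rel g x' y')
    (hlt : x < x') : y < y' := by
  have inf_le (p : Gap K) : sInf K ≤ p.1 := csInf_le hK.bddBelow p.isGap.left_mem
  have inf_le' (p : Gap K') : sInf K' ≤ p.1 := csInf_le hK'.bddBelow p.isGap.left_mem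
  have le_sup (p : Gap K) : p.right ≤ sSup K := le_csSup hK.bddAbove p.isGap.right_mem
  have le_sup' (p : Gap K') : p.right ≤ sSup K' := le_csSup hK'.bddAbove p.isGap.right_mem
  have inf_le_sup : sInf K ≤ sSup K := Real.sInf_le_sSup _ hK.bddBelow hK.bddAbove
  have inf_le_sup' : sInf K' ≤ sSup K' := Real.sInf_le_sSup _ hK'.bddBelow hK'.bddAbove
  rcases h with ⟨h₁, h₂, h₃⟩ | ⟨h₁, h₂, h₃⟩ | ⟨p, ⟨h₁, h₁'⟩, ⟨h₂, h₂'⟩, h₃⟩ <;>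
  rcases h' with ⟨k₁, k₂, k₃⟩ | ⟨k₁, k₂, k₃⟩ | ⟨q, ⟨k₁, k₁'⟩, ⟨k₂, k₂'⟩, k₃⟩
  · linarith
  · linarith
  · linarith [inf_le' (g q)]
  · linarith
  · linarith
  · linarith [le_sup q]
  · linarith [inf_le p]
  · linarith [le_sup' (g p)]
  · rcases lt_trichotomy p q with hpq | rfl | hpq
    · linarith [right_le_left (g.lt_iff_lt.2 hpq)]
    · have h₄ := mul_lt_mul_of_pos_right (sub_lt_sub_right hlt p.1) (sub_pos.2 (g p).isGap.lt)
      rw [h₃, k₃] at h₄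
      linarith [lt_of_mul_lt_mul_right h₄ (sub_pos.2 p.isGap.lt).le]
    · linarith [right_le_left hpq]

theorem lt_iff_lt (hK : IsCompact K) (hK' : IsCompact K') (h : Rel g x y) (h' : Rel g x' y') :
    x < x' ↔ y < y' :=
  ⟨lt_of_lt hK hK' h h', lt_of_lt hK' hK h.symm h'.symm⟩

theorem exists_of_notMem (hK : IsCompact K) (hne : K.Nonempty) (g : Gap K ≃o Gap K')
    (hx : x ∉ K) : ∃ y, Rel g x y := by
  rcases lt_or_ge x (sInf K) with h | h
  · exact ⟨x - sInf K + sInf K', .inl ⟨h, by linarith, by ring⟩⟩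
  rcases lt_or_ge (sSup K) x with h' | h'
  · exact ⟨x - sSup K + sSup K', .inr (.inl ⟨h', by linarith, by ring⟩)⟩
  have hinf := hK.sInf_mem hne
  have hsup := hK.sSup_mem hne
  obtain ⟨p, h₁, h₂⟩ := exists_mem hK.isClosed hinf hsup hx
    (lt_of_le_of_ne h fun e => hx (e ▸ hinf)) (lt_of_le_of_ne h' fun e => hx (e ▸ hsup))
  have hp := sub_pos.2 p.isGap.lt
  have hg := sub_pos.2 (g p).isGap.lt
  have h₀ : 0 < (x - p.1) / (p.right - p.1) := div_pos (sub_pos.2 h₁) hp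
  have h₃ : (x - p.1) / (p.right - p.1) < 1 := (div_lt_one hp).2 (by linarith)
  refine ⟨(g p).1 + (x - p.1) / (p.right - p.1) * ((g p).right - (g p).1),
    .inr (.inr ⟨p, ⟨h₁, h₂⟩, ⟨?_, ?_⟩, ?_⟩)⟩
  · linarith [mul_pos h₀ hg]
  · linarith [mul_lt_mul_of_pos_right h₃ hg]
  · field_simp
    ring

end Rel

end Gap

/-- Let `Λ, Λ* ⊆ ℝ` be Cantor sets.  Then there exists a strictly increasing
homeomorphism `φ : ℝ → ℝ` with `φ(Λ) = Λ*` (and consequently `φ(ℝ \ Λ) = ℝ \ Λ*`). -/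
theorem stmt17 (Λ Λs : Set ℝ)
    (h1 : Λ.Nonempty) (h2 : IsCompact Λ) (h3 : Perfect Λ)
    (h4 : IsTotallyDisconnected Λ)
    (h1' : Λs.Nonempty) (h2' : IsCompact Λs) (h3' : Perfect Λs)
    (h4' : IsTotallyDisconnected Λs) :
    ∃ φ : ℝ ≃ₜ ℝ, StrictMono (φ : ℝ → ℝ) ∧
      (φ : ℝ → ℝ) '' Λ = Λs ∧ (φ : ℝ → ℝ) '' Λᶜ = Λsᶜ := by
  have := Gap.denselyOrdered h3 h4
  have := Gap.noMinOrder h3 h4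
  have := Gap.noMaxOrder h3 h4
  have := Gap.nonempty h3 h4 h1
  have := Gap.denselyOrdered h3' h4'
  have := Gap.noMinOrder h3' h4'
  have := Gap.noMaxOrder h3' h4'
  have := Gap.nonempty h3' h4' h1'
  obtain ⟨g⟩ := Order.iso_of_countable_dense (Gap Λ) (Gap Λs)
  have hdom {x : ℝ} (hx : x ∉ Λ) : ∃ y, Gap.Rel g x y :=
    Gap.Rel.exists_of_notMem h2 h1 g hx
  have hran {y : ℝ} (hy : y ∉ Λs) : ∃ x, Gap.Rel g x y :=
    (Gap.Rel.exists_of_notMem h2' h1' g.symm hy).imp fun _ h => h.symm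
  obtain ⟨φ, hφ⟩ := exists_orderIso_extending (Gap.Rel g) (Gap.Rel.lt_iff_lt h2 h2')
    (fun hab => by
      obtain ⟨x, hx, hxK⟩ := h4.exists_notMem_Ioo hab
      obtain ⟨y, hy⟩ := hdom hxK
      exact ⟨x, y, hx.1, hx.2, hy⟩)
    (fun hab => by
      obtain ⟨y, hy, hyK⟩ := h4'.exists_notMem_Ioo hab
      obtain ⟨x, hx⟩ := hran hyK
      exact ⟨x, y, hy.1, hy.2, hx⟩)
  have hcompl : φ '' Λᶜ = Λsᶜ := by
    ext y
    constructor
    · rintro ⟨x, hx, rfl⟩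
      obtain ⟨y, hy⟩ := hdom hx
      exact hφ x y hy ▸ hy.symm.notMem h2'
    · intro hy
      obtain ⟨x, hx⟩ := hran hy
      exact ⟨x, hx.notMem h2, hφ x y hx⟩
  refine ⟨φ.toHomeomorph, φ.strictMono, ?_, hcompl⟩
  rw [image_compl_eq φ.bijective] at hcompl
  exact compl_injective hcompl
end

section
/- For every Cantor set Λ* ⊆ ℝ there exists a continuous function F* : ℝ → ℝ such that: (i) for every x ∈ Λ* and every n ≥ 1, (F*)ⁿ(x) ∈ Λ*; and (ii) for every x ∉ Λ*, the sequence (F*)ⁿ(x) diverges to infinity (in fact (F*)ⁿ(x) → +∞ as n → ∞). -/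
open Filter

/-- The distance to `s` from a point at height `t ≥ 0` above the greatest element `M` of `s`
is `t`. -/
theorem infDist_add_of_isGreatest {s : Set ℝ} {M t : ℝ} (hM : IsGreatest s M) (ht : 0 ≤ t) :
    Metric.infDist (M + t) s = t := by
  apply le_antisymm
  · simpa [abs_of_nonneg ht] using Metric.infDist_le_dist_of_mem (x := M + t) hM.1
  · refine (Metric.le_infDist ⟨M, hM.1⟩).2 fun y hy => ?_
    have := hM.2 hy
    rw [Real.dist_eq]
    exact le_trans (by linarith) (le_abs_self _)

/-- Iterating `y ↦ M + 2 * infDist y s`, where `M` is the greatest element of `s`, doubles the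
distance to `s` at each step. -/
theorem iterate_add_two_mul_infDist {s : Set ℝ} {M : ℝ} (hM : IsGreatest s M) (x : ℝ) (n : ℕ) :
    (fun y : ℝ => M + 2 * Metric.infDist y s)^[n + 1] x =
      M + 2 ^ (n + 1) * Metric.infDist x s := by
  induction n with
  | zero => simp
  | succ n ih =>
    have hd : 0 ≤ Metric.infDist x s := Metric.infDist_nonneg
    rw [Function.iterate_succ_apply', ih, infDist_add_of_isGreatest hM (by positivity)]
    ring

/-- For every Cantor set `Λ* ⊆ ℝ` there is a continuous `F* : ℝ → ℝ` such that
`(F*)^[n] x ∈ Λ*` for every `x ∈ Λ*` and `n ≥ 1`, and `(F*)^[n] x → +∞` for every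
`x ∉ Λ*`. -/
theorem stmt19 (Λ : Set ℝ)
    (hne : Λ.Nonempty) (hcomp : IsCompact Λ) (hperf : Perfect Λ)
    (htd : IsTotallyDisconnected Λ) :
    ∃ F : ℝ → ℝ, Continuous F ∧
      (∀ x ∈ Λ, ∀ n : ℕ, 1 ≤ n → F^[n] x ∈ Λ) ∧
      (∀ x : ℝ, x ∉ Λ → Tendsto (fun n : ℕ => F^[n] x) atTop atTop) := by
  obtain ⟨M, hM⟩ := hcomp.exists_isGreatest hne
  refine ⟨fun y => M + 2 * Metric.infDist y Λ, by fun_prop, fun x hx n hn => ?_, fun x hx => ?_⟩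
  · obtain ⟨n, rfl⟩ := Nat.exists_eq_add_of_le' hn
    rw [iterate_add_two_mul_infDist hM, Metric.infDist_zero_of_mem hx]
    simpa using hM.1
  · have hd : 0 < Metric.infDist x Λ := (hcomp.isClosed.notMem_iff_infDist_pos hne).1 hx
    rw [← tendsto_add_atTop_iff_nat 1]
    simp only [iterate_add_two_mul_infDist hM]
    exact tendsto_atTop_add_const_left _ _ <|
      ((tendsto_add_atTop_iff_nat 1).2
        (tendsto_pow_atTop_atTop_of_one_lt one_lt_two)).atTop_mul_const hd
end
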